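/- There exists a universal constant C > 0 with the following property. For every β > 2, every pair of positive integers p, d, every H > 0, every f : [0,1]^d → ℝ^p in the Hölder ball H^β([0,1]^d, H), and every integer K ≥ 2, there exists a ReQU network h_f : [0,1]^d → ℝ^p with all weights in [−1,1], with at most C(log d + ⌊β⌋ + log log(max{H,4})) hidden layers, width at most C·max{p, d(K+⌊β⌋)^d}, and at most C·p(dβ + d² + log log(max{H,4}))(K+⌊β⌋)^d nonzero weights, such that for every ℓ ∈ {0, 1, …, ⌊β⌋}: ‖f − h_f‖_{H^ℓ([0,1]^d)} ≤ C^{βd} H β^ℓ / K^{β−ℓ}. -/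

import Mathlib

open scoped BigOperators Classical

noncomputable def requ (t : ℝ) : ℝ := (max t 0) ^ 2

structure ReQUNet where
  L : ℕ
  arch : ℕ → ℕ
  W : ℕ → ℕ → ℕ → ℝ
  v : ℕ → ℕ → ℝ

namespace ReQUNet

noncomputable def hidden (N : ReQUNet) (x : ℕ → ℝ) : ℕ → ℕ → ℝ
  | 0, j => ∑ k ∈ Finset.range (N.arch 0), N.W 0 j k * x k
  | i + 1, j =>
      ∑ k ∈ Finset.range (N.arch (i + 1)),
        N.W (i + 1) j k * requ (N.hidden x i k - N.v (i + 1) k)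

noncomputable def eval (N : ReQUNet) (x : ℕ → ℝ) : ℕ → ℝ := N.hidden x N.L

noncomputable def evalVec (N : ReQUNet) (d : ℕ) (x : Fin d → ℝ) : ℕ → ℝ :=
  N.eval fun k => if h : k < d then x ⟨k, h⟩ else 0

def width (N : ReQUNet) : ℕ := (Finset.range (N.L + 2)).sup N.arch

def weightsIn (N : ReQUNet) (s : Set ℝ) : Prop :=
  (∀ i ≤ N.L, ∀ j < N.arch (i + 1), ∀ k < N.arch i, N.W i j k ∈ s) ∧
  ∀ i, 1 ≤ i → i ≤ N.L → ∀ j < N.arch i, N.v i j ∈ s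

noncomputable def numNonzero (N : ReQUNet) : ℕ :=
  (∑ i ∈ Finset.range (N.L + 1),
    ((Finset.range (N.arch (i + 1)) ×ˢ Finset.range (N.arch i)).filter
      fun p => N.W i p.1 p.2 ≠ 0).card) +
  ∑ i ∈ Finset.Icc 1 N.L,
    ((Finset.range (N.arch i)).filter fun j => N.v i j ≠ 0).card

end ReQUNet

noncomputable def pderiv1 {d : ℕ} (i : Fin d) (g : (Fin d → ℝ) → ℝ) : (Fin d → ℝ) → ℝ :=
  fun x => fderiv ℝ g x (Pi.single i 1)

noncomputable def mderiv {d : ℕ} (γ : Fin d → ℕ) (g : (Fin d → ℝ) → ℝ) : (Fin d → ℝ) → ℝ :=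
  (List.finRange d).foldr (fun i h => (pderiv1 i)^[γ i] h) g

noncomputable def eucDist {d : ℕ} (x y : Fin d → ℝ) : ℝ :=
  Real.sqrt (∑ i, (x i - y i) ^ 2)

def cube (d : ℕ) : Set (Fin d → ℝ) := Set.Icc 0 1

def cubeHO (d : ℕ) : Set (Fin d → ℝ) := Set.Ico 0 1

def HolderNormLeOn {d : ℕ} (Ω : Set (Fin d → ℝ)) : ℕ → ((Fin d → ℝ) → ℝ) → ℝ → Prop
  | 0, g, E => ∀ x ∈ Ω, |g x| ≤ E
  | m + 1, g, E =>
      (∀ γ : Fin d → ℕ, (∑ i, γ i) ≤ m → ∀ x ∈ Ω, |mderiv γ g x| ≤ E) ∧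
      ∀ γ : Fin d → ℕ, (∑ i, γ i) = m → ∀ x ∈ Ω, ∀ y ∈ Ω, x ≠ y →
        |mderiv γ g x - mderiv γ g y| ≤ E * min 1 (eucDist x y)

def VHolderNormLe {d : ℕ} (p ℓ : ℕ) (f : (Fin d → ℝ) → Fin p → ℝ) (E : ℝ) : Prop :=
  ∀ i : Fin p, HolderNormLeOn (cube d) ℓ (fun x => f x i) E

noncomputable def lfloor (β : ℝ) : ℕ := ⌈β⌉₊ - 1

def MemHolderBall {d : ℕ} (p : ℕ) (β H : ℝ) (f : (Fin d → ℝ) → Fin p → ℝ) : Prop :=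
  (∀ i : Fin p, ContDiff ℝ (lfloor β : ℕ∞) fun x => f x i) ∧
  (∀ i : Fin p, ∀ γ : Fin d → ℕ, (∑ j, γ j) ≤ lfloor β →
      ∀ x ∈ cube d, |mderiv γ (fun y => f y i) x| ≤ H) ∧
  ∀ i : Fin p, ∀ γ : Fin d → ℕ, (∑ j, γ j) = lfloor β →
      ∀ x ∈ cube d, ∀ y ∈ cube d, x ≠ y →
        |mderiv γ (fun z => f z i) x - mderiv γ (fun z => f z i) y| ≤
          H * min 1 (eucDist x y) ^ (β - (lfloor β : ℝ))

def MemHolderBall1 {d : ℕ} (β H : ℝ) (f : (Fin d → ℝ) → ℝ) : Prop :=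
  (ContDiff ℝ (lfloor β : ℕ∞) f) ∧
  (∀ γ : Fin d → ℕ, (∑ j, γ j) ≤ lfloor β → ∀ x ∈ cube d, |mderiv γ f x| ≤ H) ∧
  ∀ γ : Fin d → ℕ, (∑ j, γ j) = lfloor β →
      ∀ x ∈ cube d, ∀ y ∈ cube d, x ≠ y →
        |mderiv γ f x - mderiv γ f y| ≤ H * min 1 (eucDist x y) ^ (β - (lfloor β : ℝ))

noncomputable def loglog2 (H : ℝ) : ℝ := if H ≤ 2 then 0 else Real.logb 2 (Real.logb 2 H)

noncomputable def knot (q K j : ℕ) : ℝ :=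
  if j ≤ q + 1 then 0 else if j ≤ q + K then ((j - (q + 1) : ℕ) : ℝ) / K else 1

noncomputable def Bspl (q K : ℕ) : ℕ → ℕ → ℝ → ℝ
  | 0, j, x =>
      if knot q K j < knot q K (j + 1) ∧ knot q K j ≤ x ∧ x < knot q K (j + 1) then
        1 / (knot q K (j + 1) - knot q K j)
      else 0
  | m + 1, j, x =>
      if knot q K j < knot q K (j + m + 2) ∧ knot q K j ≤ x ∧ x < knot q K (j + m + 2) then
        ((x - knot q K j) * Bspl q K m j x
            + (knot q K (j + m + 2) - x) * Bspl q K m (j + 1) x) /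
          (knot q K (j + m + 2) - knot q K j)
      else 0

noncomputable def Nspl (q K m j : ℕ) (x : ℝ) : ℝ :=
  (knot q K (j + m + 1) - knot q K j) * Bspl q K m j x

def QRanalytic {d : ℕ} (p : ℕ) (Q R : ℝ) (f : (Fin d → ℝ) → Fin p → ℝ) : Prop :=
  (∀ i : Fin p, ContDiff ℝ (⊤ : ℕ∞) fun x => f x i) ∧
  ∀ s : ℕ, VHolderNormLe p s f (Q * ((R : ℝ) ^ s)⁻¹ * (Nat.factorial s : ℝ))

def archSpec (q K i : ℕ) : ℕ :=
  if i = 0 then 1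
  else if i = 1 then 4 * (K + 2 * q - 1) + K
  else if i ≤ 4 then 4 * K + 8 * q
  else if i ≤ 4 + 2 * (q - 2) then
    (if (i - 5) % 2 = 0 then 12 * (K + 2 * q - (3 + (i - 5) / 2)) + 12
      else 8 * (K + 2 * q - (3 + (i - 5) / 2)) + 8)
  else K + q + 2

namespace ReQUNet

/-- The output of the `i`-th layer after activation; layer `0` is the input itself. -/
noncomputable def act (N : ReQUNet) (x : ℕ → ℝ) : ℕ → ℕ → ℝ
  | 0, k => x k
  | i + 1, k => requ (N.hidden x i k - N.v (i + 1) k)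

theorem hidden_eq (N : ReQUNet) (x : ℕ → ℝ) (i j : ℕ) :
    N.hidden x i j = ∑ k ∈ Finset.range (N.arch i), N.W i j k * N.act x i k := by
  cases i <;> simp [hidden, act]

theorem act_congr {N N' : ReQUNet} {L : ℕ} (harch : ∀ i < L, N'.arch i = N.arch i)
    (hW : ∀ i < L, N'.W i = N.W i) (hv : ∀ i ≤ L, N'.v i = N.v i) (x : ℕ → ℝ) :
    N'.act x L = N.act x L := by
  induction L with
  | zero => rfl
  | succ L ih =>
    have := ih (fun i hi => harch i (by omega)) (fun i hi => hW i (by omega))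
      (fun i hi => hv i (by omega))
    funext k
    rw [act, act, hidden_eq, hidden_eq, this, harch L (by omega), hW L (by omega), hv (L + 1) le_rfl]

end ReQUNet

/-- The zero-extended input sequence fed to a network with `d` inputs. -/
def padInput (d : ℕ) (x : Fin d → ℝ) : ℕ → ℝ := fun k => if h : k < d then x ⟨k, h⟩ else 0

/-- The first `L` layers of `N` have width at most `w`, at most `n` nonzero weights, all of them in
`[-1, 1]`, and the neurons of layer `L` compute the functions `g`. -/
structure RealizedBy (d L w n : ℕ) {ι : Type} (g : ι → (Fin d → ℝ) → ℝ)
    (N : ReQUNet) (e : ι ≃ Fin (N.arch L)) : Prop where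
  arch_zero : N.arch 0 = d
  width_le : ∀ i ≤ L, N.arch i ≤ w
  W_mem : ∀ i < L, ∀ j < N.arch (i + 1), ∀ k < N.arch i, N.W i j k ∈ Set.Icc (-1 : ℝ) 1
  v_mem : ∀ i, 1 ≤ i → i ≤ L → ∀ j < N.arch i, N.v i j ∈ Set.Icc (-1 : ℝ) 1
  count_le : (∑ i ∈ Finset.range L,
      ((Finset.range (N.arch (i + 1)) ×ˢ Finset.range (N.arch i)).filter
        fun p => N.W i p.1 p.2 ≠ 0).card) +
    ∑ i ∈ Finset.Icc 1 L, ((Finset.range (N.arch i)).filter fun j => N.v i j ≠ 0).card ≤ n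
  act_eq : ∀ x k, N.act (padInput d x) L (e k) = g k x

/-- The family `g` is computed by the neurons in layer `L` of some network. -/
def Realizable (d L w n : ℕ) {ι : Type} (g : ι → (Fin d → ℝ) → ℝ) : Prop :=
  ∃ N e, RealizedBy d L w n g N e

theorem Realizable.inputs (d : ℕ) : Realizable d 0 d 0 (fun (i : Fin d) x => x i) := by
  refine ⟨⟨0, fun _ => d, 0, 0⟩, Equiv.refl _, rfl, by simp, by simp, by omega, by simp, ?_⟩
  intro x k
  simp [ReQUNet.act, padInput]

theorem card_filter_matrix_le {ι κ : Type} [Fintype ι] [Fintype κ] {a b : ℕ} (e : ι ≃ Fin a)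
    (e' : κ ≃ Fin b) (A : κ → ι → ℝ) (r : κ → ℕ)
    (hr : ∀ j, (Finset.univ.filter fun i => A j i ≠ 0).card ≤ r j) (W : ℕ → ℕ → ℝ)
    (hW : ∀ j i, W (e' j) (e i) = A j i) :
    ((Finset.range b ×ˢ Finset.range a).filter fun p => W p.1 p.2 ≠ 0).card ≤ ∑ j, r j := by
  calc _ ≤ (Finset.univ.filter fun q : κ × ι => A q.1 q.2 ≠ 0).card := by
        refine Finset.card_le_card_of_surjOn (fun q => ((e' q.1 : ℕ), (e q.2 : ℕ))) ?_
        rintro ⟨j, i⟩ h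
        simp only [Finset.coe_filter, Finset.mem_product, Finset.mem_range, Set.mem_ofPred_eq] at h
        refine ⟨(e'.symm ⟨j, h.1.1⟩, e.symm ⟨i, h.1.2⟩), ?_, by simp⟩
        have := hW (e'.symm ⟨j, h.1.1⟩) (e.symm ⟨i, h.1.2⟩)
        simp only [Equiv.apply_symm_apply] at this
        simpa [← this] using h.2
    _ = ∑ j, (Finset.univ.filter fun i => A j i ≠ 0).card := by
        simp only [Finset.card_filter]
        rw [Fintype.sum_prod_type]
    _ ≤ _ := Finset.sum_le_sum fun j _ => hr j

/-- Append one layer of neurons. -/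
theorem Realizable.step {d L w n : ℕ} {ι κ : Type} [Fintype ι] [Fintype κ]
    {g : ι → (Fin d → ℝ) → ℝ} (h : Realizable d L w n g) (A : κ → ι → ℝ) (b : κ → ℝ)
    (hA : ∀ j i, |A j i| ≤ 1) (hb : ∀ j, |b j| ≤ 1) (r : κ → ℕ)
    (hr : ∀ j, (Finset.univ.filter fun i => A j i ≠ 0).card ≤ r j) :
    Realizable d (L + 1) (max w (Fintype.card κ)) (n + ∑ j, (r j + 1))
      (fun j x => requ ((∑ i, A j i * g i x) + b j)) := by
  obtain ⟨N, e, hN⟩ := h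
  let e' : κ ≃ Fin (Fintype.card κ) := Fintype.equivFin κ
  let W' : ℕ → ℕ → ℝ := fun j i =>
    if hj : j < Fintype.card κ then
      if hi : i < N.arch L then A (e'.symm ⟨j, hj⟩) (e.symm ⟨i, hi⟩) else 0
    else 0
  let v' : ℕ → ℝ := fun j => if hj : j < Fintype.card κ then -b (e'.symm ⟨j, hj⟩) else 0
  have hW' : ∀ j i, W' (e' j) (e i) = A j i := by intro j i; simp [W']
  have hv' : ∀ j, v' (e' j) = - b j := by intro j; simp [v']
  let N' : ReQUNet :=
    { L := L + 1
      arch := fun i => if i = L + 1 then Fintype.card κ else N.arch i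
      W := fun i => if i = L then W' else N.W i
      v := fun i => if i = L + 1 then v' else N.v i }
  have hL : N'.arch (L + 1) = Fintype.card κ := by simp [N']
  have harch : ∀ i ≤ L, N'.arch i = N.arch i := fun i hi => by
    simp only [N']; rw [if_neg (by omega)]
  have hWL : N'.W L = W' := by simp [N']
  have hW : ∀ i < L, N'.W i = N.W i := fun i hi => by
    simp only [N']; rw [if_neg (by omega)]
  have hvL : N'.v (L + 1) = v' := by simp [N']
  have hv : ∀ i ≤ L, N'.v i = N.v i := fun i hi => by
    simp only [N']; rw [if_neg (by omega)]
  refine ⟨N', e'.trans (finCongr hL.symm), ?_, ?_, ?_, ?_, ?_, ?_⟩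
  · rw [harch 0 (by omega), hN.arch_zero]
  · intro i hi
    rcases Nat.lt_or_ge L i with h | h
    · obtain rfl : i = L + 1 := by omega
      rw [hL]; exact le_max_right _ _
    · rw [harch i h]; exact (hN.width_le i h).trans (le_max_left _ _)
  · intro i hi j hj k hk
    rcases Nat.lt_or_ge i L with h | h
    · rw [harch (i + 1) (by omega)] at hj
      rw [harch i (by omega)] at hk
      rw [hW i h]
      exact hN.W_mem i h j hj k hk
    · obtain rfl : i = L := by omega
      rw [hL] at hj
      rw [harch i le_rfl] at hk
      rw [hWL]
      simp only [W', hj, hk, dif_pos]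
      exact abs_le.1 (hA _ _)
  · intro i h1 hi j hj
    rcases Nat.lt_or_ge L i with h | h
    · obtain rfl : i = L + 1 := by omega
      rw [hL] at hj
      rw [hvL]
      simp only [v', hj, dif_pos]
      exact abs_le.1 (by rw [abs_neg]; exact hb _)
    · rw [harch i h] at hj
      rw [hv i h]
      exact hN.v_mem i h1 h j hj
  · rw [Finset.sum_range_succ, Finset.sum_Icc_succ_top (by omega), hL, harch L le_rfl, hWL, hvL]
    have h1 := card_filter_matrix_le e e' A r hr W' hW'
    have h2 : ((Finset.range (Fintype.card κ)).filter fun j => v' j ≠ 0).card ≤ ∑ _j : κ, 1 := by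
      refine (Finset.card_filter_le _ _).trans ?_
      simp
    have h3 := hN.count_le
    have h4 : ∀ i ∈ Finset.range L,
        ((Finset.range (N'.arch (i + 1)) ×ˢ Finset.range (N'.arch i)).filter
          fun p => N'.W i p.1 p.2 ≠ 0).card =
        ((Finset.range (N.arch (i + 1)) ×ˢ Finset.range (N.arch i)).filter
          fun p => N.W i p.1 p.2 ≠ 0).card := by
      intro i hi
      have hi := Finset.mem_range.1 hi
      rw [harch (i + 1) (by omega), harch i (by omega), hW i hi]
    have h5 : ∀ i ∈ Finset.Icc 1 L,
        ((Finset.range (N'.arch i)).filter fun j => N'.v i j ≠ 0).card =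
        ((Finset.range (N.arch i)).filter fun j => N.v i j ≠ 0).card := by
      intro i hi
      have hi := Finset.mem_Icc.1 hi
      rw [harch i hi.2, hv i hi.2]
    rw [Finset.sum_congr rfl h4, Finset.sum_congr rfl h5, Finset.sum_add_distrib]
    omega
  · intro x k
    simp only [Equiv.trans_apply, finCongr_apply, Fin.val_cast]
    rw [ReQUNet.act, ReQUNet.hidden_eq, hvL, hv', hWL, harch L le_rfl,
      ReQUNet.act_congr (fun i hi => harch i hi.le) hW hv, Finset.sum_range,
      ← Equiv.sum_comp e]
    simp only [hW', hN.act_eq, sub_neg_eq_add]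

/-- Append the affine output layer. -/
theorem Realizable.output {d L w n p : ℕ} {ι : Type} [Fintype ι]
    {g : ι → (Fin d → ℝ) → ℝ} (h : Realizable d L w n g) (A : Fin p → ι → ℝ)
    (hA : ∀ j i, |A j i| ≤ 1) :
    ∃ N : ReQUNet, N.L = L ∧ N.arch 0 = d ∧ N.arch (N.L + 1) = p ∧
      N.weightsIn (Set.Icc (-1) 1) ∧ N.width ≤ max w p ∧
      N.numNonzero ≤ n + p * Fintype.card ι ∧
      ∀ (x : Fin d → ℝ) (j : Fin p), N.evalVec d x j = ∑ i, A j i * g i x := by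
  obtain ⟨N, e, hN⟩ := h
  let W' : ℕ → ℕ → ℝ := fun j i =>
    if hj : j < p then
      if hi : i < N.arch L then A ⟨j, hj⟩ (e.symm ⟨i, hi⟩) else 0
    else 0
  have hW' : ∀ (j : Fin p) i, W' j (e i) = A j i := by intro j i; simp [W']
  let N' : ReQUNet :=
    { L := L
      arch := fun i => if i = L + 1 then p else N.arch i
      W := fun i => if i = L then W' else N.W i
      v := N.v }
  have hL : N'.arch (L + 1) = p := by simp [N']
  have harch : ∀ i ≤ L, N'.arch i = N.arch i := fun i hi => by
    simp only [N']; rw [if_neg (by omega)]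
  have hWL : N'.W L = W' := by simp [N']
  have hW : ∀ i < L, N'.W i = N.W i := fun i hi => by
    simp only [N']; rw [if_neg (by omega)]
  have hv : ∀ i ≤ L, N'.v i = N.v i := fun i hi => rfl
  refine ⟨N', rfl, ?_, hL, ⟨?_, ?_⟩, ?_, ?_, ?_⟩
  · rw [harch 0 (by omega), hN.arch_zero]
  · intro i hi j hj k hk
    change i ≤ L at hi
    rcases Nat.lt_or_ge i L with h | h
    · rw [harch (i + 1) (by omega)] at hj
      rw [harch i (by omega)] at hk
      rw [hW i h]
      exact hN.W_mem i h j hj k hk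
    · obtain rfl : i = L := by omega
      rw [hL] at hj
      rw [harch i le_rfl] at hk
      rw [hWL]
      simp only [W', hj, hk, dif_pos]
      exact abs_le.1 (hA _ _)
  · intro i h1 hi j hj
    change i ≤ L at hi
    rw [harch i hi] at hj
    exact hN.v_mem i h1 hi j hj
  · refine Finset.sup_le fun i hi => ?_
    have hi : i < L + 2 := Finset.mem_range.1 hi
    rcases Nat.lt_or_ge L i with h | h
    · obtain rfl : i = L + 1 := by omega
      rw [hL]; exact le_max_right _ _
    · rw [harch i h]; exact (hN.width_le i h).trans (le_max_left _ _)
  · change (∑ i ∈ Finset.range (L + 1), _) + ∑ i ∈ Finset.Icc 1 L, _ ≤ _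
    rw [Finset.sum_range_succ, hL, harch L le_rfl, hWL]
    have h1 := card_filter_matrix_le e (Equiv.refl (Fin p)) A (fun _ => Fintype.card ι)
      (fun j => Finset.card_le_univ _) W' hW'
    have h3 := hN.count_le
    have h4 : ∀ i ∈ Finset.range L,
        ((Finset.range (N'.arch (i + 1)) ×ˢ Finset.range (N'.arch i)).filter
          fun p => N'.W i p.1 p.2 ≠ 0).card =
        ((Finset.range (N.arch (i + 1)) ×ˢ Finset.range (N.arch i)).filter
          fun p => N.W i p.1 p.2 ≠ 0).card := by
      intro i hi
      have hi := Finset.mem_range.1 hi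
      rw [harch (i + 1) (by omega), harch i (by omega), hW i hi]
    have h5 : ∀ i ∈ Finset.Icc 1 L,
        ((Finset.range (N'.arch i)).filter fun j => N'.v i j ≠ 0).card =
        ((Finset.range (N.arch i)).filter fun j => N.v i j ≠ 0).card := by
      intro i hi
      have hi := Finset.mem_Icc.1 hi
      rw [harch i hi.2]
    rw [Finset.sum_congr rfl h4, Finset.sum_congr rfl h5]
    simp only [Finset.sum_const, Finset.card_univ, Fintype.card_fin, smul_eq_mul] at h1
    omega
  · intro x j
    change N'.hidden (padInput d x) L j = _
    rw [ReQUNet.hidden_eq, hWL, harch L le_rfl,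
      ReQUNet.act_congr (fun i hi => harch i hi.le) hW hv, Finset.sum_range, ← Equiv.sum_comp e]
    simp only [hW', hN.act_eq]

/-- Layer `L` of some network computes every function of the family `F` as a combination, with
coefficients at most `1/4`, of at most four neurons reserved for it. -/
def Computes (d L w n : ℕ) {κ : Type} (F : κ → (Fin d → ℝ) → ℝ) : Prop :=
  ∃ (ι : Type) (_ : Fintype ι) (π : ι → κ) (ε : ι → ℝ) (g : ι → (Fin d → ℝ) → ℝ),
    Realizable d L w n g ∧ (∀ i, |ε i| ≤ 1 / 4) ∧
    (∀ k, (Finset.univ.filter fun i => π i = k).card ≤ 4) ∧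
    ∀ k x, F k x = ∑ i ∈ Finset.univ.filter (fun i => π i = k), ε i * g i x

/-- `u` is an affine combination of at most `r` members of `F`, with coefficients bounded by `A` and
constant term bounded by `B`. -/
def AffineIn {d : ℕ} {κ : Type} [Fintype κ] (F : κ → (Fin d → ℝ) → ℝ) (r : ℕ) (A B : ℝ)
    (u : (Fin d → ℝ) → ℝ) : Prop :=
  ∃ (a : κ → ℝ) (b : ℝ), (∀ k, |a k| ≤ A) ∧ |b| ≤ B ∧
    (Finset.univ.filter fun k => a k ≠ 0).card ≤ r ∧ ∀ x, u x = (∑ k, a k * F k x) + b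

/-- `u` can be computed from `F` by four neurons, each having at most `r` inputs. -/
def NodeIn {d : ℕ} {κ : Type} [Fintype κ] (F : κ → (Fin d → ℝ) → ℝ) (r : ℕ)
    (u : (Fin d → ℝ) → ℝ) : Prop :=
  ∃ (ε : Fin 4 → ℝ) (v : Fin 4 → (Fin d → ℝ) → ℝ), (∀ e, |ε e| ≤ 1 / 4) ∧
    (∀ e, AffineIn F r 4 1 (v e)) ∧ ∀ x, u x = ∑ e, ε e * requ (v e x)

section AffineIn

variable {d : ℕ} {κ : Type} [Fintype κ] {F : κ → (Fin d → ℝ) → ℝ}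

theorem AffineIn.const (c : ℝ) : AffineIn F 0 0 |c| (fun _ => c) :=
  ⟨0, c, by simp, le_rfl, by simp, by simp⟩

theorem AffineIn.mono {r r' : ℕ} {A A' B B' : ℝ} {u : (Fin d → ℝ) → ℝ} (h : AffineIn F r A B u)
    (hr : r ≤ r') (hA : A ≤ A') (hB : B ≤ B') : AffineIn F r' A' B' u := by
  obtain ⟨a, b, h1, h2, h3, h4⟩ := h
  exact ⟨a, b, fun k => (h1 k).trans hA, h2.trans hB, h3.trans hr, h4⟩

theorem AffineIn.lincomb {α : Type} [Fintype α] (f : α → κ) (hf : Function.Injective f)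
    (c : α → ℝ) {A : ℝ} (hA : 0 ≤ A) (hc : ∀ i, |c i| ≤ A) :
    AffineIn F (Fintype.card α) A 0 (fun x => ∑ i, c i * F (f i) x) := by
  refine ⟨Function.extend f c 0, 0, ?_, by simp, ?_, ?_⟩
  · intro k
    by_cases hk : ∃ i, f i = k
    · obtain ⟨i, rfl⟩ := hk
      rw [hf.extend_apply]; exact hc i
    · rw [Function.extend_apply' _ _ _ hk]; simpa using hA
  · refine le_trans (Finset.card_le_card ?_) (Finset.card_image_le (s := Finset.univ) (f := f))
    intro k hk
    simp only [Finset.mem_filter, Finset.mem_univ, true_and] at hk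
    by_contra h
    refine hk (Function.extend_apply' _ _ _ ?_)
    rintro ⟨i, rfl⟩
    exact h (Finset.mem_image_of_mem _ (Finset.mem_univ i))
  · intro x
    rw [add_zero, ← Finset.sum_subset (Finset.subset_univ (Finset.univ.image f)),
      Finset.sum_image (fun _ _ _ _ h => hf h)]
    · simp only [hf.extend_apply]
    · intro k _ hk
      rw [Function.extend_apply', Pi.zero_apply, zero_mul]
      rintro ⟨i, rfl⟩
      exact hk (Finset.mem_image_of_mem _ (Finset.mem_univ i))

theorem AffineIn.smul_coord (k : κ) (c : ℝ) : AffineIn F 1 |c| 0 (fun x => c * F k x) := by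
  simpa using AffineIn.lincomb (F := F) (fun _ : Unit => k) (fun _ _ _ => rfl) (fun _ => c)
    (abs_nonneg c) (fun _ => le_rfl)

theorem AffineIn.coord (k : κ) : AffineIn F 1 1 0 (F k) := by
  simpa using AffineIn.smul_coord (F := F) k 1

theorem AffineIn.add {r r' : ℕ} {A A' B B' : ℝ} {u u' : (Fin d → ℝ) → ℝ}
    (h : AffineIn F r A B u) (h' : AffineIn F r' A' B' u') :
    AffineIn F (r + r') (A + A') (B + B') (fun x => u x + u' x) := by
  obtain ⟨a, b, h1, h2, h3, h4⟩ := h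
  obtain ⟨a', b', h1', h2', h3', h4'⟩ := h'
  refine ⟨a + a', b + b', fun k => ?_, ?_, ?_, fun x => ?_⟩
  · exact (abs_add_le _ _).trans (add_le_add (h1 k) (h1' k))
  · exact (abs_add_le _ _).trans (add_le_add h2 h2')
  · refine le_trans (Finset.card_le_card ?_) ((Finset.card_union_le _ _).trans (add_le_add h3 h3'))
    intro k hk
    simp only [Finset.mem_filter, Finset.mem_univ, true_and, Finset.mem_union, Pi.add_apply] at hk ⊢
    by_contra! h
    exact hk (by rw [h.1, h.2, add_zero])
  · simp only [h4, h4', Pi.add_apply, add_mul, Finset.sum_add_distrib]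
    ring

theorem AffineIn.neg {r : ℕ} {A B : ℝ} {u : (Fin d → ℝ) → ℝ}
    (h : AffineIn F r A B u) : AffineIn F r A B (fun x => - u x) := by
  obtain ⟨a, b, h1, h2, h3, h4⟩ := h
  exact ⟨-a, -b, by simpa using h1, by simpa using h2, by simpa using h3, fun x => by
    simp [h4]; ring⟩

theorem AffineIn.sub {r r' : ℕ} {A A' B B' : ℝ} {u u' : (Fin d → ℝ) → ℝ}
    (h : AffineIn F r A B u) (h' : AffineIn F r' A' B' u') :
    AffineIn F (r + r') (A + A') (B + B') (fun x => u x - u' x) := by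
  simpa only [sub_eq_add_neg] using h.add h'.neg

theorem requ_add_requ_neg (t : ℝ) : requ t + requ (-t) = t ^ 2 := by
  unfold requ
  rcases le_total t 0 with h | h
  · rw [max_eq_right h, max_eq_left (by linarith)]; ring
  · rw [max_eq_left h, max_eq_right (by linarith)]; ring

theorem NodeIn.mul {r r' : ℕ} {A A' B B' : ℝ} {u u' : (Fin d → ℝ) → ℝ}
    (h : AffineIn F r A B u) (h' : AffineIn F r' A' B' u') (hA : A + A' ≤ 4) (hB : B + B' ≤ 1) :
    NodeIn F (r + r') (fun x => u x * u' x) := by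
  refine ⟨![1 / 4, 1 / 4, -(1 / 4), -(1 / 4)],
    ![fun x => u x + u' x, fun x => -(u x + u' x), fun x => u x - u' x, fun x => -(u x - u' x)],
    ?_, ?_, ?_⟩
  · intro e; fin_cases e <;> norm_num
  · intro e
    fin_cases e
    · exact (h.add h').mono le_rfl hA hB
    · exact (h.add h').neg.mono le_rfl hA hB
    · exact (h.sub h').mono le_rfl hA hB
    · exact (h.sub h').neg.mono le_rfl hA hB
  · intro x
    have h1 := requ_add_requ_neg (u x + u' x)
    have h2 := requ_add_requ_neg (u x - u' x)
    simp only [Fin.sum_univ_four, Matrix.cons_val]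
    linear_combination (-1 / 4) * h1 + (1 / 4) * h2

theorem NodeIn.requ_comp {r : ℕ} {u : (Fin d → ℝ) → ℝ} (h : AffineIn F r 4 1 u) :
    NodeIn F r (fun x => requ (u x)) := by
  refine ⟨fun _ => 1 / 4, fun _ => u, by norm_num, fun _ => h, fun x => ?_⟩
  simp

theorem NodeIn.congr {r r' : ℕ} {u u' : (Fin d → ℝ) → ℝ} (h : NodeIn F r u) (hr : r ≤ r')
    (hu : ∀ x, u' x = u x) : NodeIn F r' u' := by
  obtain ⟨ε, v, h1, h2, h3⟩ := h
  exact ⟨ε, v, h1, fun e => (h2 e).mono hr le_rfl le_rfl, fun x => (hu x).trans (h3 x)⟩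

theorem NodeIn.carry (k : κ) : NodeIn F 1 (F k) := by
  simpa using NodeIn.mul (AffineIn.coord (F := F) k) (AffineIn.const 1) (by norm_num)
    (by norm_num)

theorem NodeIn.one : NodeIn F 0 (fun _ => 1) := by
  have := NodeIn.requ_comp ((AffineIn.const (F := F) 1).mono le_rfl (by norm_num) (by norm_num))
  simpa [requ] using this

theorem NodeIn.zero : NodeIn F 0 (fun _ => 0) := by
  have := NodeIn.requ_comp ((AffineIn.const (F := F) 0).mono le_rfl (by norm_num) (by norm_num))
  simpa [requ] using this

end AffineIn

theorem Computes.inputs (d : ℕ) : Computes d 0 d 0 (fun (i : Fin d) x => (1 / 4) * x i) := by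
  refine ⟨Fin d, inferInstance, id, fun _ => 1 / 4, _, Realizable.inputs d, by norm_num, ?_, ?_⟩
  · intro k
    simp [Finset.filter_eq']
  · intro k x
    simp [Finset.filter_eq']

theorem Computes.mono {d L w n w' n' : ℕ} {κ : Type} {F : κ → (Fin d → ℝ) → ℝ}
    (h : Computes d L w n F) (hw : w ≤ w') (hn : n ≤ n') : Computes d L w' n' F := by
  obtain ⟨ι, _, π, ε, g, ⟨N, e, hN⟩, h⟩ := h
  exact ⟨ι, _, π, ε, g, ⟨N, e, hN.arch_zero, fun i hi => (hN.width_le i hi).trans hw, hN.W_mem,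
    hN.v_mem, hN.count_le.trans hn, hN.act_eq⟩, h⟩

theorem card_filter_comp_le {ι κ : Type} [Fintype ι] [Fintype κ] (π : ι → κ)
    (hπ : ∀ k, (Finset.univ.filter fun i => π i = k).card ≤ 4) (a : κ → ℝ) (ε : ι → ℝ) :
    (Finset.univ.filter fun i => a (π i) * ε i ≠ 0).card ≤
      4 * (Finset.univ.filter fun k => a k ≠ 0).card := by
  refine (Finset.card_le_mul_card_image_of_maps_to (f := π) ?_ 4 ?_)
  · intro i hi
    simp only [Finset.mem_filter, Finset.mem_univ, true_and] at hi ⊢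
    exact left_ne_zero_of_mul hi
  · intro k _
    refine (Finset.card_le_card ?_).trans (hπ k)
    exact Finset.filter_subset_filter _ (Finset.subset_univ _)

theorem sum_mul_fiber_sum {ι κ : Type} [Fintype ι] [Fintype κ] (π : ι → κ) (a : κ → ℝ) (ε g : ι → ℝ) :
    ∑ k, a k * ∑ i ∈ Finset.univ.filter (fun i => π i = k), ε i * g i =
      ∑ i, a (π i) * ε i * g i := by
  rw [← Finset.sum_fiberwise (s := Finset.univ) (g := π) (f := fun i => a (π i) * ε i * g i)]
  refine Finset.sum_congr rfl fun k _ => ?_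
  rw [Finset.mul_sum]
  refine Finset.sum_congr rfl fun i hi => ?_
  rw [(Finset.mem_filter.1 hi).2]; ring

/-- Append a layer computing the nodes `F'`. -/
theorem Computes.step {d L w n : ℕ} {κ κ' : Type} [Fintype κ] [Fintype κ']
    {F : κ → (Fin d → ℝ) → ℝ} (h : Computes d L w n F) {F' : κ' → (Fin d → ℝ) → ℝ}
    (r : κ' → ℕ) (hF' : ∀ j, NodeIn F (r j) (F' j)) :
    Computes d (L + 1) (max w (4 * Fintype.card κ')) (n + ∑ j, 4 * (4 * r j + 1)) F' := by
  obtain ⟨ι, _, π, ε, g, hg, hε, hπ, hF⟩ := h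
  choose ε' v hε' hv hF'v using hF'
  choose a b ha hb hr hvab using hv
  have key := hg.step (κ := κ' × Fin 4) (fun q i => a q.1 q.2 (π i) * ε i) (fun q => b q.1 q.2)
    (fun q i => by
      rw [abs_mul]
      have h1 := ha q.1 q.2 (π i)
      have h2 := hε i
      calc _ ≤ 4 * (1 / 4 : ℝ) := mul_le_mul h1 h2 (abs_nonneg _) (by norm_num)
        _ = 1 := by norm_num)
    (fun q => hb _ _) (fun q => 4 * r q.1)
    (fun q => (card_filter_comp_le π hπ _ _).trans (by have := hr q.1 q.2; omega))
  have e1 : Fintype.card (κ' × Fin 4) = 4 * Fintype.card κ' := by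
    rw [Fintype.card_prod, Fintype.card_fin, mul_comm]
  have e2 : ∑ q : κ' × Fin 4, (4 * r q.1 + 1) = ∑ j, 4 * (4 * r j + 1) := by
    rw [Fintype.sum_prod_type]; simp
  rw [e1, e2] at key
  refine ⟨κ' × Fin 4, inferInstance, Prod.fst, fun q => ε' q.1 q.2, _, key,
    fun q => hε' _ _, fun k => ?_, fun k x => ?_⟩
  · have : (Finset.univ.filter fun i : κ' × Fin 4 => i.1 = k) ⊆
        Finset.univ.image (fun e : Fin 4 => (k, e)) := by
      rintro ⟨k', e⟩ h
      simp only [Finset.mem_filter, Finset.mem_univ, true_and] at h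
      subst h; simp
    exact (Finset.card_le_card this).trans (Finset.card_image_le.trans (by simp))
  · rw [Finset.sum_filter, Fintype.sum_prod_type, Finset.sum_eq_single k]
    · rw [hF'v]
      refine Finset.sum_congr rfl fun e _ => ?_
      simp only [if_true, hvab, hF]
      rw [sum_mul_fiber_sum]
    · intro k' _ hk'
      simp [hk']
    · simp

/-- Append an output layer with coefficients at most `4`. -/
theorem Computes.output {d L w n p : ℕ} {κ : Type} [Fintype κ]
    {F : κ → (Fin d → ℝ) → ℝ} (h : Computes d L w n F) (a : Fin p → κ → ℝ)
    (ha : ∀ j k, |a j k| ≤ 4) :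
    ∃ N : ReQUNet, N.L = L ∧ N.arch 0 = d ∧ N.arch (N.L + 1) = p ∧
      N.weightsIn (Set.Icc (-1) 1) ∧ N.width ≤ max w p ∧
      N.numNonzero ≤ n + p * (4 * Fintype.card κ) ∧
      ∀ (x : Fin d → ℝ) (j : Fin p), N.evalVec d x j = ∑ k, a j k * F k x := by
  obtain ⟨ι, _, π, ε, g, hg, hε, hπ, hF⟩ := h
  obtain ⟨N, h1, h2, h3, h4, h5, h6, h7⟩ := hg.output (fun j i => a j (π i) * ε i) (fun j i => by
    rw [abs_mul]
    calc _ ≤ 4 * (1 / 4 : ℝ) := mul_le_mul (ha _ _) (hε i) (abs_nonneg _) (by norm_num)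
      _ = 1 := by norm_num)
  refine ⟨N, h1, h2, h3, h4, h5, h6.trans ?_, fun x j => ?_⟩
  · gcongr
    have := Finset.card_le_mul_card_image_of_maps_to (f := π) (s := Finset.univ) (t := Finset.univ)
      (by simp) 4 (by simpa using hπ)
    simpa using this
  · rw [h7]
    simp only [hF]
    rw [sum_mul_fiber_sum]

theorem Computes.reindex {d L w n : ℕ} {κ κ' : Type} {F : κ → (Fin d → ℝ) → ℝ}
    (h : Computes d L w n F) (e : κ' ≃ κ) : Computes d L w n (fun k => F (e k)) := by
  obtain ⟨ι, _, π, ε, g, hg, hε, hπ, hF⟩ := h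
  have he : ∀ i k, (e.symm (π i) = k) = (π i = e k) := fun i k => by
    rw [Equiv.symm_apply_eq]
  refine ⟨ι, ‹_›, fun i => e.symm (π i), ε, g, hg, hε, fun k => ?_, fun k x => ?_⟩
  · simp only [he]; exact hπ (e k)
  · simp only [he]; exact hF (e k) x

/-- Products of `2 ^ c` functions by a binary tree of multiplications. -/
theorem Computes.prod_tree {d w : ℕ} {J : Type} [Fintype J] (c : ℕ) :
    ∀ (m L n : ℕ), m = 2 ^ c → 4 * (Fintype.card J * m) ≤ w →
    ∀ {F : J × Fin m → (Fin d → ℝ) → ℝ}, Computes d L w n F →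
    Computes d (L + c) w (n + c * (36 * (Fintype.card J * m)))
      (fun j x => ∏ a, F (j, a) x) := by
  induction c with
  | zero =>
    intro m L n hm hw F h
    obtain rfl : m = 1 := hm
    have := h.reindex (Equiv.prodUnique J (Fin 1)).symm
    simpa using this
  | succ c ih =>
    intro m L n hm hw F h
    obtain ⟨l, rfl, hl⟩ : ∃ l, m = l * 2 ∧ l = 2 ^ c := ⟨2 ^ c, by rw [hm, pow_succ], rfl⟩
    have hs := h.step (κ' := J × Fin l)
      (F' := fun q x => F (q.1, finProdFinEquiv (q.2, 0)) x * F (q.1, finProdFinEquiv (q.2, 1)) x)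
      (fun _ => 2)
      (fun q => NodeIn.mul (AffineIn.coord _) (AffineIn.coord _) (by norm_num) (by norm_num))
    have hcard : Fintype.card (J × Fin l) = Fintype.card J * l := by simp
    have hs' := ih l (L + 1) _ hl (by nlinarith)
      (hs.mono (w' := w) (by rw [hcard]; exact max_le le_rfl (by nlinarith)) le_rfl)
    convert hs'.mono le_rfl (n' := n + (c + 1) * (36 * (Fintype.card J * (l * 2)))) ?_ using 1
    · ring
    · funext j x
      rw [← Equiv.prod_comp finProdFinEquiv, Fintype.prod_prod_type]
      simp [Fin.prod_univ_two]
    · simp only [Finset.sum_const, Finset.card_univ, hcard, smul_eq_mul]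
      nlinarith [Nat.zero_le (c * (Fintype.card J * l))]

/-- The smooth step of degree `q`: the `q`-th backward difference of the normalised truncated
power. It vanishes for `y ≤ 0` and equals `1` for `y ≥ q`. -/
noncomputable def smoothStep (q : ℕ) (y : ℝ) : ℝ :=
  ∑ i ∈ Finset.range (q + 1), ((-1) ^ i * (q.choose i : ℝ) / q.factorial) * (max (y - i) 0) ^ q

/-- A smooth step with transition interval `[(m - 1) / M, m / M]`. -/
noncomputable def cutoff (q M m : ℕ) (t : ℝ) : ℝ :=
  if m = 0 then 1 else if m ≤ M then smoothStep q (q * (M * t - ((m : ℝ) - 1))) else 0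

/-- The partition of unity on the line, `bump q M m` being concentrated around `m / M`. -/
noncomputable def bump (q M m : ℕ) (t : ℝ) : ℝ := cutoff q M m t - cutoff q M (m + 1) t

theorem cutoff_eq (q M m : ℕ) (h0 : m ≠ 0) (hm : m ≤ M) (hq : 0 < q) (t : ℝ) :
    cutoff q M m t = ((q * M : ℕ) : ℝ) ^ q *
      ∑ i ∈ Finset.range (q + 1), ((-1) ^ i * (q.choose i : ℝ) / q.factorial) *
        (max (t - ((q * (m - 1) + i : ℕ) : ℝ) / ((q * M : ℕ) : ℝ)) 0) ^ q := by
  have hN : (0 : ℝ) < ((q * M : ℕ) : ℝ) := by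
    exact_mod_cast Nat.mul_pos hq (by omega)
  rw [cutoff, if_neg h0, if_pos hm, smoothStep, Finset.mul_sum]
  refine Finset.sum_congr rfl fun i _ => ?_
  have : (q : ℝ) * (M * t - ((m : ℝ) - 1)) - i =
      ((q * M : ℕ) : ℝ) * (t - ((q * (m - 1) + i : ℕ) : ℝ) / ((q * M : ℕ) : ℝ)) := by
    rw [mul_sub ((q * M : ℕ) : ℝ), mul_div_cancel₀ _ hN.ne']
    push_cast [Nat.cast_sub (Nat.one_le_iff_ne_zero.2 h0)]
    ring
  rw [this, ← mul_zero ((q * M : ℕ) : ℝ), ← mul_max_of_nonneg _ _ hN.le, mul_zero, mul_pow]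
  ring

theorem abs_choose_div_factorial_le (q i : ℕ) (hi : i ≤ q) :
    |(-1 : ℝ) ^ i * (q.choose i : ℝ) / q.factorial| ≤ 1 := by
  rw [abs_div, abs_mul, abs_pow, abs_neg, abs_one, one_pow, one_mul, Nat.abs_cast, Nat.abs_cast,
    div_le_one (by positivity)]
  exact_mod_cast Nat.le_of_dvd (Nat.factorial_pos q)
    ⟨i.factorial * (q - i).factorial, by rw [← Nat.choose_mul_factorial_mul_factorial hi]; ring⟩

/-- The univariate functions carried along while powers are formed one factor at a time. -/
noncomputable def powerStage (d q M r : ℕ) :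
    Fin d ⊕ Fin (q * M) ⊕ Unit ⊕ (Fin d × Fin (q * M + 1)) ⊕ (Fin d × Fin (M + 1) × Fin q) →
      (Fin d → ℝ) → ℝ
  | .inl i, x => x i
  | Sum.inr (.inl _), _ => 1
  | Sum.inr (.inr (.inl _)), _ => ((q * M : ℕ) : ℝ) ^ r
  | Sum.inr (.inr (.inr (.inl (i, j)))), x =>
      (max (x i - (j : ℕ) / ((q * M : ℕ) : ℝ)) 0) ^ min (r + 2) q
  | Sum.inr (.inr (.inr (.inr (i, m, k)))), x => (x i - (m : ℕ) / (M : ℝ)) ^ min (k : ℕ) r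

theorem natCast_div_mem_unit {j N : ℕ} (h : j ≤ N) : (j : ℝ) / N ∈ Set.Icc (0 : ℝ) 1 :=
  ⟨by positivity, div_le_one_of_le₀ (by exact_mod_cast h) (by positivity)⟩

theorem abs_natCast_div_le_one {j N : ℕ} (h : j ≤ N) : |(j : ℝ) / N| ≤ 1 := by
  rw [abs_of_nonneg (natCast_div_mem_unit h).1]; exact (natCast_div_mem_unit h).2

theorem computes_powerStage_zero (d q M : ℕ) (hq : 2 ≤ q) :
    Computes d 1
      (max d (4 * (d + (q * M + (1 + (d * (q * M + 1) + d * ((M + 1) * q)))))))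
      (20 * d + 4 * (q * M) + 4 + 20 * (d * (q * M + 1)) + 4 * (d * ((M + 1) * q)))
      (powerStage d q M 0) := by
  have h := (Computes.inputs d).step (F' := powerStage d q M 0)
    (Sum.elim (fun _ => 1) (Sum.elim (fun _ => 0) (Sum.elim (fun _ => 0)
      (Sum.elim (fun _ => 1) (fun _ => 0))))) ?_
  · refine h.mono ?_ ?_
    · simp
    · simp [Fintype.sum_sum_type]
      linarith
  · have hx : ∀ i : Fin d,
        AffineIn (fun (i : Fin d) (x : Fin d → ℝ) => (1 / 4) * x i) 1 4 0 (fun x => x i) := by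
      intro i
      have := AffineIn.smul_coord (F := fun (i : Fin d) (x : Fin d → ℝ) => (1 / 4) * x i) i 4
      convert this using 1
      · norm_num
      · funext x; ring
    rintro (i | _ | _ | ⟨i, j⟩ | ⟨i, m, k⟩)
    · refine (NodeIn.mul (hx i) (AffineIn.const 1) (by norm_num) (by norm_num)).congr (by simp)
        fun x => ?_
      simp [powerStage]
    · exact NodeIn.one
    · refine NodeIn.one.congr (by simp) fun x => ?_
      simp [powerStage]
    · have := NodeIn.requ_comp (((hx i).sub
        (AffineIn.const ((j : ℕ) / ((q * M : ℕ) : ℝ)))).mono le_rfl (by norm_num)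
        (by simpa using abs_natCast_div_le_one (Nat.lt_succ_iff.1 j.2)))
      refine this.congr (by simp) fun x => ?_
      simp [powerStage, requ, hq]
    · refine NodeIn.one.congr (by simp) fun x => ?_
      simp [powerStage]

theorem computes_powerStage_succ {d q M r L w n : ℕ}
    (h : Computes d L w n (powerStage d q M r)) :
    Computes d (L + 1)
      (max w (4 * (d + (q * M + (1 + (d * (q * M + 1) + d * ((M + 1) * q)))))))
      (n + (20 * d + 20 * (q * M) + 20 + 52 * (d * (q * M + 1)) + 52 * (d * ((M + 1) * q))))
      (powerStage d q M (r + 1)) := by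
  have h := h.step (F' := powerStage d q M (r + 1))
    (Sum.elim (fun _ => 1) (Sum.elim (fun _ => 0) (Sum.elim (fun _ => q * M + 1)
      (Sum.elim (fun _ => 3) (fun _ => 3))))) ?_
  · refine h.mono ?_ ?_
    · simp
    · simp [Fintype.sum_sum_type]
      linarith
  · have hx : ∀ (i : Fin d) (c : ℝ), |c| ≤ 1 →
        AffineIn (powerStage d q M r) 1 1 1 (fun x => x i - c) := by
      intro i c hc
      have h1 : AffineIn (powerStage d q M r) 1 1 0 (fun x => x i) :=
        AffineIn.coord (F := powerStage d q M r) (Sum.inl i)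
      exact (h1.sub (AffineIn.const c)).mono le_rfl (by norm_num) (by simpa using hc)
    rintro (i | _ | _ | ⟨i, j⟩ | ⟨i, m, k⟩)
    · exact NodeIn.carry (F := powerStage d q M r) (Sum.inl i)
    · exact NodeIn.one
    · have := NodeIn.mul (AffineIn.lincomb (F := powerStage d q M r)
        (fun a : Fin (q * M) => Sum.inr (.inl a))
        (fun a b h => by simpa using h) (fun _ => 1) zero_le_one (by simp))
        (AffineIn.coord (Sum.inr (.inr (.inl ())))) (by norm_num) (by norm_num)
      refine this.congr (by simp) fun x => ?_
      simp [powerStage, pow_succ, mul_comm]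
    · by_cases hr : r + 2 < q
      · have := NodeIn.mul (hx i ((j : ℕ) / ((q * M : ℕ) : ℝ))
          (abs_natCast_div_le_one (Nat.lt_succ_iff.1 j.2)))
          (AffineIn.coord (Sum.inr (.inr (.inr (.inl (i, j)))))) (by norm_num) (by norm_num)
        refine this.congr (by simp) fun x => ?_
        simp only [powerStage]
        rw [min_eq_left (by omega), min_eq_left (by omega)]
        rcases le_total (x i - (j : ℕ) / ((q * M : ℕ) : ℝ)) 0 with h | h
        · rw [max_eq_right h]; simp
        · rw [max_eq_left h]; ring
      · have := NodeIn.carry (F := powerStage d q M r) (Sum.inr (.inr (.inr (.inl (i, j)))))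
        refine this.congr (by simp) fun x => ?_
        simp only [powerStage]
        rw [min_eq_right (by omega), min_eq_right (by omega)]
    · by_cases hr : r < k
      · have := NodeIn.mul (hx i ((m : ℕ) / (M : ℝ))
          (abs_natCast_div_le_one (Nat.lt_succ_iff.1 m.2)))
          (AffineIn.coord (Sum.inr (.inr (.inr (.inr (i, m, k)))))) (by norm_num) (by norm_num)
        refine this.congr (by simp) fun x => ?_
        simp only [powerStage]
        rw [min_eq_right (by omega), min_eq_right (by omega)]
        ring
      · have := NodeIn.carry (F := powerStage d q M r) (Sum.inr (.inr (.inr (.inr (i, m, k)))))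
        refine this.congr (by simp) fun x => ?_
        simp only [powerStage]
        rw [min_eq_left (by omega), min_eq_left (by omega)]

theorem computes_powerStage {d q M U : ℕ} (hd : 0 < d) (hq : 2 ≤ q) (hU : (M + 1) * q ≤ U)
    (r : ℕ) :
    Computes d (r + 1) (16 * (d * U)) ((r + 1) * (148 * (d * U))) (powerStage d q M r) := by
  have hN : q * M + 1 ≤ U := by nlinarith
  have h1 : d * (q * M + 1) ≤ d * U := Nat.mul_le_mul le_rfl hN
  have h2 : d * ((M + 1) * q) ≤ d * U := Nat.mul_le_mul le_rfl hU
  have h3 : U ≤ d * U := Nat.le_mul_of_pos_left _ hd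
  have h4 : d ≤ d * U := Nat.le_mul_of_pos_right _ (by omega)
  induction r with
  | zero =>
    refine (computes_powerStage_zero d q M hq).mono (max_le ?_ ?_) ?_ <;> omega
  | succ r ih =>
    refine (computes_powerStage_succ ih).mono (max_le ?_ ?_) ?_
    · omega
    · omega
    · rw [add_mul (r + 1) 1]; omega

/-- The cutoffs together with the powers of the shifted coordinates. -/
noncomputable def cutoffStage (d q M : ℕ) :
    (Fin d × Fin (M + 2)) ⊕ (Fin d × Fin (M + 1) × Fin q) → (Fin d → ℝ) → ℝ
  | .inl (i, m), x => cutoff q M m (x i)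
  | .inr (i, m, k), x => (x i - (m : ℕ) / (M : ℝ)) ^ (k : ℕ)

theorem computes_cutoffStage {d q M U : ℕ} (hd : 0 < d) (hq : 2 ≤ q) (hU : (M + 1) * q ≤ U) :
    Computes d (q + 2) (16 * (d * U)) ((q + 2) * (148 * (d * U))) (cutoffStage d q M) := by
  have h := (computes_powerStage hd hq hU q).step (F' := cutoffStage d q M)
    (Sum.elim (fun _ => q + 2) (fun _ => 1)) ?_
  · have h1 : d * ((M + 1) * q) ≤ d * U := Nat.mul_le_mul le_rfl hU
    have h2 : d * (M + 2) * (4 * (q + 2) + 1) ≤ 26 * (d * ((M + 1) * q)) := by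
      calc d * (M + 2) * (4 * (q + 2) + 1) ≤ d * (2 * (M + 1)) * (13 * q) := by
            gcongr <;> omega
        _ = _ := by ring
    have h3 : d * (M + 2) ≤ 2 * (d * ((M + 1) * q)) := by
      calc d * (M + 2) ≤ d * (2 * ((M + 1) * 1)) := by gcongr; omega
        _ ≤ d * (2 * ((M + 1) * q)) := by gcongr; omega
        _ = _ := by ring
    refine h.mono (max_le le_rfl ?_) ?_
    · simp; nlinarith
    · simp [Fintype.sum_sum_type]
      nlinarith
  · rintro (⟨i, m⟩ | ⟨i, m, k⟩)
    · by_cases h0 : (m : ℕ) = 0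
      · refine NodeIn.one.congr (by simp) fun x => ?_
        simp [cutoffStage, cutoff, h0]
      by_cases hm : (m : ℕ) ≤ M
      · have hlt : ∀ a : Fin (q + 1), q * (m - 1) + a < q * M + 1 := by
          intro a
          have : q * (m - 1) + q ≤ q * M := by
            calc q * (m - 1) + q = q * ((m - 1) + 1) := by ring
              _ ≤ q * M := Nat.mul_le_mul le_rfl (by omega)
          have := a.2
          omega
        have := NodeIn.mul (AffineIn.coord (F := powerStage d q M q) (Sum.inr (.inr (.inl ()))))
          (AffineIn.lincomb (fun a : Fin (q + 1) =>
            Sum.inr (.inr (.inr (.inl (i, ⟨q * (m - 1) + a, hlt a⟩)))))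
          (fun a b h => by simpa [Fin.ext_iff] using h)
          (fun a => (-1) ^ (a : ℕ) * (q.choose a : ℝ) / q.factorial) zero_le_one
          (fun a => abs_choose_div_factorial_le q a (Nat.lt_succ_iff.1 a.2)))
          (by norm_num) (by norm_num)
        refine this.congr (by simp; omega) fun x => ?_
        simp only [cutoffStage, powerStage]
        rw [cutoff_eq q M m h0 hm (by omega), Finset.sum_range, min_eq_right (by omega)]
      · refine NodeIn.zero.congr (by simp) fun x => ?_
        simp [cutoffStage, cutoff, h0, hm]
    · have := NodeIn.carry (F := powerStage d q M q) (Sum.inr (.inr (.inr (.inr (i, m, k)))))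
      refine this.congr (by simp) fun x => ?_
      simp [powerStage, cutoffStage]

/-- The univariate factors of the products of bumps and shifted powers, padded by ones to a power of
two. -/
noncomputable def leafStage (d q M m : ℕ) :
    (Fin d → Fin (M + 1) × Fin q) × Fin m → (Fin d → ℝ) → ℝ := fun σ x =>
  if h : (σ.2 : ℕ) < d then
    bump q M (σ.1 ⟨σ.2, h⟩).1 (x ⟨σ.2, h⟩) *
      (x ⟨σ.2, h⟩ - ((σ.1 ⟨σ.2, h⟩).1 : ℕ) / (M : ℝ)) ^ ((σ.1 ⟨σ.2, h⟩).2 : ℕ)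
  else 1

theorem Computes.leafStage {d q M L w n : ℕ} (m : ℕ) (h : Computes d L w n (cutoffStage d q M)) :
    Computes d (L + 1) (max w (4 * (((M + 1) * q) ^ d * m)))
      (n + 52 * (((M + 1) * q) ^ d * m)) (leafStage d q M m) := by
  have h := h.step (F' := _root_.leafStage d q M m) (fun _ => 3) ?_
  · refine h.mono ?_ ?_
    · simp
    · simp; linarith
  · rintro ⟨τ, a⟩
    by_cases ha : (a : ℕ) < d
    · have := NodeIn.mul (((AffineIn.coord (F := cutoffStage d q M)
        (Sum.inl (⟨a, ha⟩, (τ ⟨a, ha⟩).1.castSucc))).sub (AffineIn.coord (F := cutoffStage d q M)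
        (Sum.inl (⟨a, ha⟩, (τ ⟨a, ha⟩).1.succ)))))
        (AffineIn.coord (F := cutoffStage d q M) (Sum.inr (⟨a, ha⟩, τ ⟨a, ha⟩)))
        (by norm_num) (by norm_num)
      refine this.congr le_rfl fun x => ?_
      simp [cutoffStage, _root_.leafStage, ha, bump]
    · refine NodeIn.one.congr (by simp) fun x => ?_
      simp [_root_.leafStage, ha]

theorem prod_leafStage {d q M m : ℕ} (hm : d ≤ m) (τ : Fin d → Fin (M + 1) × Fin q)
    (x : Fin d → ℝ) :
    ∏ a, leafStage d q M m (τ, a) x =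
      ∏ i, bump q M (τ i).1 (x i) * (x i - ((τ i).1 : ℕ) / (M : ℝ)) ^ ((τ i).2 : ℕ) := by
  obtain ⟨e, rfl⟩ := Nat.exists_eq_add_of_le hm
  rw [Fin.prod_univ_add]
  simp [leafStage]

/-- A family together with a constant that grows doubly exponentially. -/
noncomputable def withScale {d : ℕ} {J : Type} (F : J → (Fin d → ℝ) → ℝ) (r : ℕ) :
    J ⊕ Unit → (Fin d → ℝ) → ℝ :=
  Sum.elim F fun _ _ => 4 ^ (2 ^ r - 1)

theorem Computes.withScale {d L w n : ℕ} {J : Type} [Fintype J] {F : J → (Fin d → ℝ) → ℝ}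
    (h : Computes d L w n F) (r : ℕ) :
    Computes d (L + 1 + r) (max w (4 * (Fintype.card J + 1)))
      (n + (r + 1) * (36 * (Fintype.card J + 1))) (withScale F r) := by
  induction r with
  | zero =>
    refine (h.step (F' := _root_.withScale F 0) (Sum.elim (fun _ => 1) fun _ => 0) ?_).mono ?_ ?_
    · rintro (j | _)
      · exact NodeIn.carry j
      · exact NodeIn.one.congr le_rfl fun x => by simp [_root_.withScale]
    · simp
    · simp [Fintype.sum_sum_type]; linarith
  | succ r ih =>
    refine (ih.step (F' := _root_.withScale F (r + 1)) (Sum.elim (fun _ => 1) fun _ => 2) ?_).mono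
      ?_ ?_
    · rintro (j | _)
      · exact NodeIn.carry (F := _root_.withScale F r) (Sum.inl j)
      · have := NodeIn.mul (AffineIn.smul_coord (F := _root_.withScale F r) (Sum.inr ()) 2)
          (AffineIn.smul_coord (F := _root_.withScale F r) (Sum.inr ()) 2)
          (by norm_num) (by norm_num)
        refine this.congr le_rfl fun x => ?_
        have h1 : 2 ^ (r + 1) - 1 = (2 ^ r - 1) + (2 ^ r - 1) + 1 := by
          have := Nat.one_le_two_pow (n := r)
          rw [pow_succ]; omega
        simp only [_root_.withScale, Sum.elim_inr, h1]
        rw [pow_succ, pow_add]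
        ring
    · simp
    · simp [Fintype.sum_sum_type]; linarith

/-- Combinations of products of bumps and shifted powers, with coefficients at most `4 ^ 2 ^ r`, are
computed by a network with weights in `[-1, 1]`. -/
theorem exists_net_sum_bump {d p q M U : ℕ} (hd : 0 < d) (hq : 2 ≤ q) (hU : (M + 1) * q ≤ U) (r : ℕ)
    (c : Fin p → (Fin d → Fin (M + 1) × Fin q) → ℝ) (hc : ∀ j τ, |c j τ| ≤ 4 ^ 2 ^ r) :
    ∃ N : ReQUNet, N.arch 0 = d ∧ N.arch (N.L + 1) = p ∧ N.weightsIn (Set.Icc (-1) 1) ∧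
      N.L = q + Nat.clog 2 d + r + 5 ∧ N.width ≤ max (16 * (d * U ^ d)) p ∧
      N.numNonzero ≤ (1000 * (d * q + d * Nat.clog 2 d + r) + 4 * p) * U ^ d ∧
      ∀ (x : Fin d → ℝ) (j : Fin p), N.evalVec d x j = ∑ τ, c j τ *
        ∏ i, bump q M (τ i).1 (x i) * (x i - ((τ i).1 : ℕ) / (M : ℝ)) ^ ((τ i).2 : ℕ) := by
  set k := Nat.clog 2 d with hk
  have hk1 : d ≤ 2 ^ k := Nat.le_pow_clog (by norm_num) d
  have hk2 : 2 ^ k ≤ 2 * d := by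
    rcases Nat.lt_or_ge 1 d with h1 | h1
    · have h2 := Nat.pow_pred_clog_lt_self (b := 2) (by norm_num) h1
      have h3 : 0 < k := Nat.clog_pos (by norm_num) h1
      rw [← hk] at h2
      obtain ⟨l, hl⟩ : ∃ l, k = l + 1 := ⟨k - 1, by omega⟩
      rw [hl, Nat.pred_succ] at h2
      rw [hl, pow_succ]; omega
    · have : k = 0 := by rw [hk]; exact Nat.clog_of_right_le_one h1 2
      rw [this]; omega
  have hU1 : 1 ≤ U := by nlinarith
  have hJ : ((M + 1) * q) ^ d ≤ U ^ d := Nat.pow_le_pow_left hU d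
  have hUd : U ≤ U ^ d := Nat.le_self_pow hd.ne' U
  have hdU : d * U ≤ d * U ^ d := Nat.mul_le_mul le_rfl hUd
  have hJk : ((M + 1) * q) ^ d * 2 ^ k ≤ 2 * (d * U ^ d) :=
    (Nat.mul_le_mul hJ hk2).trans_eq (by ring)
  have h1d : U ^ d ≤ d * U ^ d := Nat.le_mul_of_pos_left _ hd
  have hUd1 : 1 ≤ U ^ d := Nat.one_le_pow _ _ hU1
  have h1 := ((computes_cutoffStage hd hq hU).leafStage (2 ^ k)).mono
    (w' := 16 * (d * U ^ d)) (max_le (by omega) (by omega)) le_rfl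
  have hcard : Fintype.card (Fin d → Fin (M + 1) × Fin q) = ((M + 1) * q) ^ d := by simp
  have h2 := Computes.prod_tree k (2 ^ k) _ _ rfl (by rw [hcard]; omega) h1
  simp only [prod_leafStage hk1] at h2
  have h3 := (h2.withScale r).mono (w' := 16 * (d * U ^ d))
    (max_le le_rfl (by rw [hcard]; omega)) le_rfl
  set Φ : (Fin d → Fin (M + 1) × Fin q) → (Fin d → ℝ) → ℝ := fun τ x =>
    ∏ i, bump q M (τ i).1 (x i) * (x i - ((τ i).1 : ℕ) / (M : ℝ)) ^ ((τ i).2 : ℕ)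
  have h4 := (h3.step (F' := fun τ x => Φ τ x * 4 ^ (2 ^ r - 1)) (fun _ => 2) fun τ =>
    NodeIn.mul (AffineIn.coord (F := withScale Φ r) (Sum.inl τ))
      (AffineIn.coord (F := withScale Φ r) (Sum.inr ())) (by norm_num) (by norm_num)).mono
    (w' := 16 * (d * U ^ d)) (max_le le_rfl (by rw [hcard]; omega)) le_rfl
  have h4r : (4 : ℝ) ^ 2 ^ r = 4 * 4 ^ (2 ^ r - 1) := by
    rw [← pow_succ', Nat.sub_add_cancel Nat.one_le_two_pow]
  obtain ⟨N, e1, e2, e3, e4, e5, e6, e7⟩ := h4.output (fun j τ => c j τ / 4 ^ (2 ^ r - 1))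
    (fun j τ => by
      rw [abs_div, abs_of_pos (a := (4 : ℝ) ^ (2 ^ r - 1)) (by positivity),
        div_le_iff₀ (by positivity), ← h4r]
      exact hc j τ)
  refine ⟨N, e2, e3, e4, by rw [e1]; ring, e5, e6.trans ?_, fun x j => ?_⟩
  · simp only [Finset.sum_const, Finset.card_univ, hcard, smul_eq_mul]
    set J := ((M + 1) * q) ^ d
    set V := U ^ d
    have b1 : (q + 2) * (148 * (d * U)) ≤ 2 * q * (148 * (d * V)) := by gcongr; omega
    have b2 : k * (36 * (J * 2 ^ k)) ≤ k * (36 * (2 * (d * V))) := by gcongr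
    have b3 : (r + 1) * (36 * (J + 1)) ≤ (r + 1) * (36 * (V + V)) := by gcongr
    have b4 : p * (4 * J) ≤ p * (4 * V) := by gcongr
    have b5 : 2 * (d * V) ≤ q * (d * V) := by gcongr
    calc _ ≤ 2 * q * (148 * (d * V)) + 52 * (q * (d * V)) + k * (36 * (2 * (d * V)))
        + (r + 1) * (36 * (V + V)) + 36 * V + p * (4 * V) := by omega
      _ ≤ _ := by nlinarith [Nat.zero_le (k * (d * V)), Nat.zero_le (r * V)]
  · rw [e7]
    refine Finset.sum_congr rfl fun τ _ => ?_
    field_simp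
    rfl

theorem hasDerivAt_max_zero_pow (n : ℕ) (t : ℝ) :
    HasDerivAt (fun t : ℝ => (max t 0) ^ (n + 2)) ((n + 2) * (max t 0) ^ (n + 1)) t := by
  rcases lt_trichotomy t 0 with h | rfl | h
  · have : (fun t : ℝ => (max t 0) ^ (n + 2)) =ᶠ[nhds t] fun _ => 0 := by
      filter_upwards [Iio_mem_nhds h] with y hy
      rw [max_eq_right (le_of_lt hy)]; simp
    rw [max_eq_right h.le]
    simpa using (hasDerivAt_const t (0 : ℝ)).congr_of_eventuallyEq this
  · rw [max_self, zero_pow (by omega), mul_zero, hasDerivAt_iff_isLittleO_nhds_zero]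
    have h1 : (fun h : ℝ => (max h 0) ^ (n + 2)) =O[nhds 0] fun h => h ^ (n + 2) := by
      refine Asymptotics.IsBigO.of_bound 1 (Filter.Eventually.of_forall fun h => ?_)
      rw [one_mul, norm_pow, norm_pow]
      gcongr
      rw [Real.norm_eq_abs, Real.norm_eq_abs, abs_of_nonneg (le_max_right _ _)]
      exact max_le (le_abs_self _) (abs_nonneg _)
    have h2 : (fun h : ℝ => h ^ (n + 2)) =o[nhds 0] fun h => h :=
      Asymptotics.isLittleO_pow_id (by omega)
    simpa using h1.trans_isLittleO h2
  · have : (fun t : ℝ => (max t 0) ^ (n + 2)) =ᶠ[nhds t] fun t => t ^ (n + 2) := by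
      filter_upwards [Ioi_mem_nhds h] with y hy
      rw [max_eq_left (le_of_lt hy)]
    rw [max_eq_left h.le]
    refine ((hasDerivAt_pow (n + 2) t).congr_of_eventuallyEq this).congr_deriv ?_
    push_cast; rfl

/-- The `q`-th backward difference of the truncated power of degree `n`, normalised by `n!`. -/
noncomputable def truncDiff (q n : ℕ) (y : ℝ) : ℝ :=
  ∑ i ∈ Finset.range (q + 1), ((-1) ^ i * (q.choose i : ℝ) / n.factorial) * (max (y - i) 0) ^ n

theorem hasDerivAt_truncDiff (q n : ℕ) (y : ℝ) :
    HasDerivAt (truncDiff q (n + 2)) (truncDiff q (n + 1) y) y := by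
  unfold truncDiff
  refine (HasDerivAt.fun_sum (A' := fun i : ℕ => ((-1) ^ i * (q.choose i : ℝ) / (n + 2).factorial) *
    ((n + 2) * (max (y - i) 0) ^ (n + 1))) fun i _ => ?_).congr_deriv ?_
  · exact ((hasDerivAt_max_zero_pow n (y - i)).comp_sub_const y (i : ℝ)).const_mul _
  · refine Finset.sum_congr rfl fun i _ => ?_
    rw [Nat.factorial_succ (n + 1)]
    push_cast
    have : (n : ℝ) + 1 + 1 ≠ 0 := by positivity
    field_simp
    ring

theorem deriv_truncDiff (q n : ℕ) : deriv (truncDiff q (n + 2)) = truncDiff q (n + 1) :=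
  funext fun y => (hasDerivAt_truncDiff q n y).deriv

theorem contDiff_truncDiff (q n : ℕ) : ContDiff ℝ n (truncDiff q (n + 1)) := by
  induction n with
  | zero =>
    rw [Nat.cast_zero, contDiff_zero]
    unfold truncDiff
    fun_prop
  | succ n ih =>
    have h := contDiff_succ_iff_deriv (𝕜 := ℝ) (n := (n : WithTop ℕ∞)) (f := truncDiff q (n + 2))
    push_cast
    rw [h]
    refine ⟨fun y => (hasDerivAt_truncDiff q n y).differentiableAt, by simp, ?_⟩
    rw [deriv_truncDiff]
    exact ih

theorem iteratedDeriv_truncDiff (q n k : ℕ) :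
    iteratedDeriv k (truncDiff q (n + 1 + k)) = truncDiff q (n + 1) := by
  induction k with
  | zero => simp
  | succ k ih =>
    rw [iteratedDeriv_succ', show n + 1 + (k + 1) = n + k + 2 by ring, deriv_truncDiff,
      show n + k + 1 = n + 1 + k by ring, ih]

theorem truncDiff_of_nonpos (q n : ℕ) {y : ℝ} (hy : y ≤ 0) : truncDiff q (n + 1) y = 0 := by
  refine Finset.sum_eq_zero fun i _ => ?_
  rw [max_eq_right (by linarith [Nat.cast_nonneg (α := ℝ) i])]
  simp

theorem truncDiff_of_ge (q n : ℕ) {y : ℝ} (hn : n ≤ q) (hy : (q : ℝ) ≤ y) :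
    truncDiff q n y = if n = q then 1 else 0 := by
  have h1 : truncDiff q n y =
      (∑ i ∈ Finset.range (q + 1), ((-1 : ℝ) ^ i * (q.choose i : ℝ)) * (y - i) ^ n) /
        n.factorial := by
    rw [Finset.sum_div]
    refine Finset.sum_congr rfl fun i hi => ?_
    have : (i : ℝ) ≤ q := by exact_mod_cast Nat.lt_succ_iff.1 (Finset.mem_range.1 hi)
    rw [max_eq_left (by linarith)]
    ring
  have h2 := fwdDiff_iter_eq_sum_shift (1 : ℝ) (fun r : ℝ => r ^ n) q (y - q)
  rw [← Finset.sum_range_reflect] at h2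
  have h3 : ∑ i ∈ Finset.range (q + 1), ((-1 : ℝ) ^ i * (q.choose i : ℝ)) * (y - i) ^ n =
      (fwdDiff 1)^[q] (fun r : ℝ => r ^ n) (y - q) := by
    rw [h2]
    refine Finset.sum_congr rfl fun i hi => ?_
    have hi' : i ≤ q := Nat.lt_succ_iff.1 (Finset.mem_range.1 hi)
    have e1 : q + 1 - 1 - i = q - i := by omega
    rw [e1, Nat.sub_sub_self hi', Nat.choose_symm hi', zsmul_eq_mul, nsmul_eq_mul, Nat.cast_sub hi']
    push_cast
    congr 2
    ring
  rw [h1, h3]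
  split_ifs with h
  · subst h
    rw [fwdDiff_iter_eq_factorial]
    simp [Nat.factorial_ne_zero]
  · rw [fwdDiff_iter_pow_eq_zero_of_lt (by omega)]
    simp

theorem abs_truncDiff_le (q n : ℕ) (hn : n + 1 ≤ q) (y : ℝ) : |truncDiff q (n + 1) y| ≤ 6 ^ q := by
  rcases le_total y 0 with h0 | h0
  · rw [truncDiff_of_nonpos q n h0]; simp
  rcases le_total (q : ℝ) y with h1 | h1
  · rw [truncDiff_of_ge q _ hn h1]
    have : (1 : ℝ) ≤ 6 ^ q := one_le_pow₀ (by norm_num)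
    split_ifs
    · simpa using this
    · simp
  have hexp : (q : ℝ) ^ (n + 1) / (n + 1).factorial ≤ 3 ^ q := by
    refine (Real.pow_div_factorial_le_exp _ q.cast_nonneg _).trans ?_
    rw [← mul_one (q : ℝ), Real.exp_nat_mul]
    exact pow_le_pow_left₀ (Real.exp_pos _).le Real.exp_one_lt_three.le _
  calc |truncDiff q (n + 1) y|
      ≤ ∑ i ∈ Finset.range (q + 1), (q.choose i : ℝ) * 3 ^ q := by
        refine (Finset.abs_sum_le_sum_abs _ _).trans (Finset.sum_le_sum fun i _ => ?_)
        rw [abs_mul, abs_div, abs_mul, abs_pow, abs_neg, abs_one, one_pow, one_mul, Nat.abs_cast,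
          Nat.abs_cast, abs_of_nonneg (by positivity), div_mul_eq_mul_div, mul_div_assoc]
        gcongr
        refine le_trans ?_ hexp
        gcongr
        exact max_le (by linarith [Nat.cast_nonneg (α := ℝ) i]) q.cast_nonneg
    _ = 6 ^ q := by
        rw [← Finset.sum_mul, ← Nat.cast_sum, Nat.sum_range_choose, Nat.cast_pow, ← mul_pow]
        norm_num

theorem contDiff_cutoff (s M m : ℕ) : ContDiff ℝ s (cutoff (s + 1) M m) := by
  unfold cutoff
  split_ifs
  · exact contDiff_const
  · exact (contDiff_truncDiff (s + 1) s).comp (by fun_prop)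
  · exact contDiff_const

theorem contDiff_bump (s M m : ℕ) : ContDiff ℝ s (bump (s + 1) M m) :=
  (contDiff_cutoff s M m).sub (contDiff_cutoff s M (m + 1))

theorem iteratedDeriv_cutoff {s M m k : ℕ} (h0 : m ≠ 0) (hm : m ≤ M) (hk : k ≤ s) (t : ℝ) :
    iteratedDeriv k (cutoff (s + 1) M m) t = (((s + 1 : ℕ) : ℝ) * M) ^ k *
      truncDiff (s + 1) (s - k + 1) ((s + 1 : ℕ) * (M * t - ((m : ℝ) - 1))) := by
  have h1 : cutoff (s + 1) M m = fun t => (fun u => truncDiff (s + 1) (s + 1)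
      (u - (s + 1 : ℕ) * ((m : ℝ) - 1))) ((((s + 1 : ℕ) : ℝ) * M) * t) := by
    funext t
    rw [cutoff, if_neg h0, if_pos hm]
    change truncDiff _ _ _ = truncDiff _ _ _
    congr 1; ring
  have hc : ContDiff ℝ k fun u => truncDiff (s + 1) (s + 1) (u - (s + 1 : ℕ) * ((m : ℝ) - 1)) :=
    ((contDiff_truncDiff (s + 1) s).comp (by fun_prop)).of_le (by exact_mod_cast hk)
  rw [h1, iteratedDeriv_comp_const_mul hc, iteratedDeriv_comp_sub_const]
  have := iteratedDeriv_truncDiff (s + 1) (s - k) k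
  rw [show s - k + 1 + k = s + 1 by omega] at this
  simp only [this]
  congr 2; ring

theorem iteratedDeriv_cutoff_of_le {s M m k : ℕ} (h0 : m ≠ 0) (hk : k ≤ s) {t : ℝ}
    (ht : (M : ℝ) * t ≤ m - 1) : iteratedDeriv k (cutoff (s + 1) M m) t = 0 := by
  by_cases hm : m ≤ M
  · rw [iteratedDeriv_cutoff h0 hm hk, truncDiff_of_nonpos, mul_zero]
    exact mul_nonpos_of_nonneg_of_nonpos (Nat.cast_nonneg _) (by linarith)
  · have : cutoff (s + 1) M m = fun _ => 0 := by
      funext t; simp [cutoff, h0, hm]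
    rw [this, iteratedDeriv_const, ite_self]

theorem iteratedDeriv_cutoff_of_ge {s M m k : ℕ} (hm : m ≤ M) (hk : k ≤ s) {t : ℝ}
    (ht : (m : ℝ) ≤ M * t) : iteratedDeriv k (cutoff (s + 1) M m) t = if k = 0 then 1 else 0 := by
  by_cases h0 : m = 0
  · have : cutoff (s + 1) M m = fun _ => 1 := by
      funext t; simp [cutoff, h0]
    rw [this, iteratedDeriv_const]
  · rw [iteratedDeriv_cutoff h0 hm hk, truncDiff_of_ge _ _ (by omega)
      (le_mul_of_one_le_right (Nat.cast_nonneg _) (by linarith))]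
    rcases Nat.eq_zero_or_pos k with rfl | hk0
    · simp
    · rw [if_neg (by omega), if_neg (by omega), mul_zero]

theorem abs_iteratedDeriv_cutoff_le {s M m k : ℕ} (hk : k ≤ s) (t : ℝ) :
    |iteratedDeriv k (cutoff (s + 1) M m) t| ≤
      6 ^ (s + 1) * (((s + 1 : ℕ) : ℝ) * (max M 1 : ℕ)) ^ k := by
  have h6 : (1 : ℝ) ≤ 6 ^ (s + 1) := one_le_pow₀ (by norm_num)
  have hpos : (0 : ℝ) ≤ 6 ^ (s + 1) * (((s + 1 : ℕ) : ℝ) * (max M 1 : ℕ)) ^ k := by positivity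
  by_cases h0 : m = 0
  · have : cutoff (s + 1) M m = fun _ => 1 := by
      funext t; simp [cutoff, h0]
    rw [this, iteratedDeriv_const]
    split_ifs with hk0
    · subst hk0; simpa using h6
    · simpa using hpos
  by_cases hm : m ≤ M
  · rw [iteratedDeriv_cutoff h0 hm hk, abs_mul, abs_of_nonneg (by positivity), mul_comm]
    gcongr
    · exact abs_truncDiff_le _ _ (by omega) _
    · exact le_max_left _ _
  · have : cutoff (s + 1) M m = fun _ => 0 := by
      funext t; simp [cutoff, h0, hm]
    rw [this, iteratedDeriv_const, ite_self]
    simpa using hpos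

theorem iteratedDeriv_bump {s M m k : ℕ} (hk : k ≤ s) (t : ℝ) :
    iteratedDeriv k (bump (s + 1) M m) t =
      iteratedDeriv k (cutoff (s + 1) M m) t - iteratedDeriv k (cutoff (s + 1) M (m + 1)) t :=
  iteratedDeriv_fun_sub ((contDiff_cutoff s M m).of_le (by exact_mod_cast hk)).contDiffAt
    ((contDiff_cutoff s M (m + 1)).of_le (by exact_mod_cast hk)).contDiffAt

theorem abs_iteratedDeriv_bump_le {s M m k : ℕ} (hk : k ≤ s) (t : ℝ) :
    |iteratedDeriv k (bump (s + 1) M m) t| ≤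
      (2 * 6 ^ (s + 1)) * (((s + 1 : ℕ) : ℝ) * (max M 1 : ℕ)) ^ k := by
  rw [iteratedDeriv_bump hk, two_mul, add_mul]
  exact (abs_sub _ _).trans
    (add_le_add (abs_iteratedDeriv_cutoff_le hk t) (abs_iteratedDeriv_cutoff_le hk t))

theorem iteratedDeriv_bump_eq_zero {s M m k : ℕ} (hk : k ≤ s) (hm : m ≤ M) {t : ℝ}
    (ht : t ∈ Set.Icc (0 : ℝ) 1) (h : ((max M 1 : ℕ) : ℝ)⁻¹ < |t - m / M|) :
    iteratedDeriv k (bump (s + 1) M m) t = 0 := by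
  rw [iteratedDeriv_bump hk]
  rcases Nat.eq_zero_or_pos M with rfl | hM
  · simp [abs_of_nonneg ht.1] at h
    linarith [ht.2]
  have hM' : (0 : ℝ) < M := by exact_mod_cast hM
  rw [max_eq_left (Nat.one_le_iff_ne_zero.2 hM.ne')] at h
  have h' : 1 < |M * t - m| := by
    have : (M : ℝ) * t - m = M * (t - m / M) := by field_simp
    rw [this, abs_mul, abs_of_pos hM']
    calc (1 : ℝ) = M * (M : ℝ)⁻¹ := by field_simp
      _ < _ := by gcongr
  rcases lt_abs.1 h' with h1 | h1
  · have hlt : (m : ℝ) + 1 < M := by nlinarith [ht.2]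
    have hlt' : m + 1 < M := by exact_mod_cast hlt
    rw [iteratedDeriv_cutoff_of_ge hm hk (by linarith),
      iteratedDeriv_cutoff_of_ge hlt'.le hk (by push_cast; linarith), sub_self]
  · have h0 : m ≠ 0 := by
      rintro rfl
      have := mul_nonneg hM'.le ht.1
      simp at h1
      linarith
    rw [iteratedDeriv_cutoff_of_le h0 hk (by linarith),
      iteratedDeriv_cutoff_of_le (Nat.succ_ne_zero m) hk (by push_cast; linarith), sub_self]

theorem sum_bump (q M : ℕ) (t : ℝ) : ∑ m : Fin (M + 1), bump q M m t = 1 := by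
  rw [← Finset.sum_range (fun m => bump q M m t)]
  unfold bump
  rw [Finset.sum_range_sub']
  simp [cutoff]

theorem card_near_le (M : ℕ) (t : ℝ) :
    (Finset.univ.filter fun m : Fin (M + 1) =>
      |t - (m : ℕ) / (M : ℝ)| ≤ ((max M 1 : ℕ) : ℝ)⁻¹).card ≤ 3 := by
  rcases Nat.eq_zero_or_pos M with rfl | hM
  · refine (Finset.card_le_univ _).trans ?_
    simp
  have hM' : (0 : ℝ) < M := by exact_mod_cast hM
  rw [max_eq_left (Nat.one_le_iff_ne_zero.2 hM.ne')]
  have : Finset.image (fun m : Fin (M + 1) => ((m : ℕ) : ℤ)) (Finset.univ.filter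
      fun m : Fin (M + 1) => |t - (m : ℕ) / (M : ℝ)| ≤ (M : ℝ)⁻¹) ⊆
      Finset.Icc ⌈M * t - 1⌉ (⌈M * t - 1⌉ + 2) := by
    intro z hz
    obtain ⟨m, hm, rfl⟩ := Finset.mem_image.1 hz
    have hm' := (Finset.mem_filter.1 hm).2
    have h1 : |M * t - (m : ℕ)| ≤ 1 := by
      have : (M : ℝ) * t - (m : ℕ) = M * (t - (m : ℕ) / M) := by field_simp
      rw [this, abs_mul, abs_of_pos hM']
      calc _ ≤ M * (M : ℝ)⁻¹ := by gcongr
        _ = 1 := by field_simp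
    rw [abs_le] at h1
    rw [Finset.mem_Icc]
    constructor
    · rw [Int.ceil_le]; push_cast; linarith
    · have h2 := Int.le_ceil (M * t - 1)
      have h3 : ((m : ℕ) : ℝ) ≤ (⌈M * t - 1⌉ + 2 : ℤ) := by push_cast; linarith
      exact_mod_cast h3
  rw [← Finset.card_image_of_injective _
    (show Function.Injective fun m : Fin (M + 1) => ((m : ℕ) : ℤ) from fun a b h => by
      simpa [Fin.ext_iff] using h)]
  refine (Finset.card_le_card this).trans ?_
  rw [Int.card_Icc]
  omega

section pderivs

variable {d : ℕ}

theorem ContDiff.pderiv1 {g : (Fin d → ℝ) → ℝ} {n : ℕ} (hg : ContDiff ℝ (n + 1 : ℕ) g) (i : Fin d) :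
    ContDiff ℝ n (pderiv1 i g) :=
  (hg.fderiv_right (by push_cast; rfl)).clm_apply contDiff_const

theorem contDiff_foldr_pderiv1 {g : (Fin d → ℝ) → ℝ} {n : ℕ} (l : List (Fin d))
    (hg : ContDiff ℝ (n + l.length : ℕ) g) : ContDiff ℝ n (l.foldr pderiv1 g) := by
  induction l generalizing n with
  | nil => simpa using hg
  | cons i l ih =>
    refine ContDiff.pderiv1 (ih ?_) i
    rwa [List.length_cons, ← add_assoc, add_right_comm] at hg

theorem pderiv1_comm {g : (Fin d → ℝ) → ℝ} (hg : ContDiff ℝ 2 g) (i j : Fin d) :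
    pderiv1 i (pderiv1 j g) = pderiv1 j (pderiv1 i g) := by
  have hd : Differentiable ℝ (fderiv ℝ g) :=
    (hg.fderiv_right (m := 1) (by norm_num)).differentiable (by norm_num)
  funext x
  have h := (hg.contDiffAt (x := x)).isSymmSndFDerivAt (by simp)
  unfold pderiv1
  rw [fderiv_clm_apply (hd x) (by fun_prop), fderiv_clm_apply (hd x) (by fun_prop)]
  simpa using h.eq (Pi.single i 1) (Pi.single j 1)

theorem foldr_pderiv1_perm {g : (Fin d → ℝ) → ℝ} {l l' : List (Fin d)} (h : l.Perm l')
    (hg : ContDiff ℝ l.length g) : l.foldr pderiv1 g = l'.foldr pderiv1 g := by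
  induction h with
  | nil => rfl
  | cons i h ih =>
    simp only [List.foldr_cons]
    rw [ih (hg.of_le (by simp))]
  | swap i j l =>
    simp only [List.foldr_cons]
    refine pderiv1_comm (contDiff_foldr_pderiv1 (n := 2) l (hg.of_le ?_)) _ _
    simp only [List.length_cons]
    norm_cast
    omega
  | trans h1 h2 ih1 ih2 =>
    rw [ih1 hg, ih2 (by rwa [← h1.length_eq])]

theorem foldr_pderiv1_ofFn {g : (Fin d → ℝ) → ℝ} {n : ℕ} (v : Fin n → Fin d) (hg : ContDiff ℝ n g)
    (x : Fin d → ℝ) : (List.ofFn v).foldr pderiv1 g x =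
      iteratedFDeriv ℝ n g x fun k => Pi.single (v k) 1 := by
  induction n generalizing x with
  | zero => simp
  | succ n ih =>
    rw [List.ofFn_succ, List.foldr_cons, iteratedFDeriv_succ_apply_left]
    have h1 := funext (ih (fun k => v k.succ) (hg.of_le (by norm_cast; omega)))
    rw [pderiv1, h1, fderiv_continuousMultilinear_apply_const_apply]
    · rfl
    · exact (hg.differentiable_iteratedFDeriv (by norm_cast; omega)) x

theorem mderiv_eq_foldr (γ : Fin d → ℕ) (g : (Fin d → ℝ) → ℝ) :
    mderiv γ g = ((List.finRange d).flatMap fun i => List.replicate (γ i) i).foldr pderiv1 g := by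
  rw [List.foldr_flatMap, mderiv]
  congr 1
  funext i h
  induction γ i with
  | zero => rfl
  | succ n ih => rw [Function.iterate_succ_apply', ih, List.replicate_succ, List.foldr_cons]

theorem length_flatMap_replicate (γ : Fin d → ℕ) :
    ((List.finRange d).flatMap fun i => List.replicate (γ i) i).length = ∑ i, γ i := by
  simp [List.length_flatMap, ← List.ofFn_eq_map, List.sum_ofFn]

/-- A mixed partial derivative is an iterated derivative in coordinate directions. -/
theorem exists_mderiv_eq (γ : Fin d → ℕ) {n : ℕ} (hn : ∑ i, γ i = n) :
    ∃ v : Fin n → Fin d, ∀ g : (Fin d → ℝ) → ℝ, ContDiff ℝ n g →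
      ∀ x, mderiv γ g x = iteratedFDeriv ℝ n g x fun k => Pi.single (v k) 1 := by
  obtain ⟨l, hl⟩ : ∃ l, l = (List.finRange d).flatMap fun i => List.replicate (γ i) i := ⟨_, rfl⟩
  have hlen : l.length = n := by rw [hl, length_flatMap_replicate, hn]
  subst hlen
  refine ⟨l.get, fun g hg x => ?_⟩
  rw [← foldr_pderiv1_ofFn l.get hg, List.ofFn_get, mderiv_eq_foldr, hl]

theorem norm_pi_single_one (i : Fin d) : ‖(Pi.single i 1 : Fin d → ℝ)‖ = 1 :=
  (Pi.norm_single (G := fun _ : Fin d => ℝ) (1 : ℝ)).trans norm_one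

theorem abs_mderiv_le {γ : Fin d → ℕ} {n : ℕ} (hn : ∑ i, γ i = n) {g : (Fin d → ℝ) → ℝ}
    (hg : ContDiff ℝ n g) (x : Fin d → ℝ) : |mderiv γ g x| ≤ ‖iteratedFDeriv ℝ n g x‖ := by
  obtain ⟨v, hv⟩ := exists_mderiv_eq γ hn
  rw [hv g hg x, ← Real.norm_eq_abs]
  refine (ContinuousMultilinearMap.le_opNorm _ _).trans ?_
  simp [norm_pi_single_one]

theorem abs_mderiv_sub_le {γ : Fin d → ℕ} {n : ℕ} (hn : ∑ i, γ i = n) {g : (Fin d → ℝ) → ℝ}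
    (hg : ContDiff ℝ n g) (x y : Fin d → ℝ) :
    |mderiv γ g x - mderiv γ g y| ≤ ‖iteratedFDeriv ℝ n g x - iteratedFDeriv ℝ n g y‖ := by
  obtain ⟨v, hv⟩ := exists_mderiv_eq γ hn
  rw [hv g hg x, hv g hg y, ← Real.norm_eq_abs, ← sub_apply]
  refine (ContinuousMultilinearMap.le_opNorm _ _).trans ?_
  simp [norm_pi_single_one]

/-- Each iterated derivative in coordinate directions is a mixed partial derivative. -/
theorem exists_iteratedFDeriv_eq {n : ℕ} (v : Fin n → Fin d) :
    ∃ γ : Fin d → ℕ, ∑ i, γ i = n ∧ ∀ g : (Fin d → ℝ) → ℝ, ContDiff ℝ n g →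
      ∀ x, iteratedFDeriv ℝ n g x (fun k => Pi.single (v k) 1) = mderiv γ g x := by
  have hperm : (List.ofFn v).Perm
      ((List.finRange d).flatMap fun i => List.replicate ((List.ofFn v).count i) i) := by
    rw [List.perm_iff_count]
    intro i
    rw [List.count_flatMap]
    simp [Function.comp_def, List.count_replicate, ← List.ofFn_eq_map, List.sum_ofFn]
  refine ⟨fun i => (List.ofFn v).count i, ?_, fun g hg x => ?_⟩
  · rw [← length_flatMap_replicate, ← hperm.length_eq, List.length_ofFn]
  · rw [mderiv_eq_foldr, ← foldr_pderiv1_perm hperm (by simpa using hg), foldr_pderiv1_ofFn v hg]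

theorem norm_le_of_coordinate_bound {n : ℕ}
    (L : ContinuousMultilinearMap ℝ (fun _ : Fin n => Fin d → ℝ) ℝ) {B : ℝ}
    (hL : ∀ v : Fin n → Fin d, |L fun k => Pi.single (v k) 1| ≤ B) : ‖L‖ ≤ d ^ n * B := by
  have hB : 0 ≤ (d : ℝ) ^ n * B := by
    by_cases h : Nonempty (Fin n → Fin d)
    · exact mul_nonneg (by positivity) ((abs_nonneg _).trans (hL (Classical.choice h)))
    · have : Fintype.card (Fin n → Fin d) = 0 := Fintype.card_eq_zero_iff.2 (not_nonempty_iff.1 h)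
      have h2 : (d : ℝ) ^ n = 0 := by exact_mod_cast (by simpa using this : d ^ n = 0)
      rw [h2, zero_mul]
  refine ContinuousMultilinearMap.opNorm_le_bound hB fun m => ?_
  have h1 : m = fun k => ∑ i, m k i • (Pi.single i 1 : Fin d → ℝ) :=
    funext fun k => pi_eq_sum_univ' (m k)
  conv_lhs => rw [h1]
  rw [ContinuousMultilinearMap.map_sum]
  refine (norm_sum_le _ _).trans ?_
  calc ∑ r : Fin n → Fin d, ‖L fun k => m k (r k) • (Pi.single (r k) 1 : Fin d → ℝ)‖
      ≤ ∑ _r : Fin n → Fin d, B * ∏ k, ‖m k‖ := by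
        refine Finset.sum_le_sum fun r _ => ?_
        rw [ContinuousMultilinearMap.map_smul_univ, norm_smul, norm_prod, mul_comm]
        gcongr with k
        · exact (abs_nonneg _).trans (hL r)
        · exact hL r
        · exact norm_le_pi_norm (m k) (r k)
    _ = _ := by simp [mul_assoc]

theorem norm_iteratedFDeriv_sub_le {n : ℕ} {g : (Fin d → ℝ) → ℝ} (hg : ContDiff ℝ n g) {B : ℝ}
    {x y : Fin d → ℝ}
    (h : ∀ γ : Fin d → ℕ, ∑ i, γ i = n → |mderiv γ g x - mderiv γ g y| ≤ B) :
    ‖iteratedFDeriv ℝ n g x - iteratedFDeriv ℝ n g y‖ ≤ d ^ n * B := by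
  refine norm_le_of_coordinate_bound _ fun v => ?_
  obtain ⟨γ, hγ, hv⟩ := exists_iteratedFDeriv_eq v
  rw [sub_apply, hv g hg, hv g hg]
  exact h γ hγ

theorem iteratedFDeriv_eq_of_mderiv_eq {n : ℕ} {g g' : (Fin d → ℝ) → ℝ} (hg : ContDiff ℝ n g)
    (hg' : ContDiff ℝ n g') {x y : Fin d → ℝ}
    (h : ∀ γ : Fin d → ℕ, ∑ i, γ i = n → mderiv γ g x = mderiv γ g' y) :
    iteratedFDeriv ℝ n g x = iteratedFDeriv ℝ n g' y := by
  rw [← sub_eq_zero, ← norm_le_zero_iff]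
  refine (norm_le_of_coordinate_bound (B := 0) _ fun v => ?_).trans (by simp)
  obtain ⟨γ, hγ, hv⟩ := exists_iteratedFDeriv_eq v
  rw [sub_apply, hv g hg, hv g' hg', h γ hγ, sub_self, abs_zero]

theorem mderiv_sum_mul {ι : Type} [Fintype ι] (γ : Fin d → ℕ) {g : ι → (Fin d → ℝ) → ℝ}
    (hg : ∀ j, ContDiff ℝ (∑ i, γ i : ℕ) (g j)) (c : ι → ℝ) (x : Fin d → ℝ) :
    mderiv γ (fun x => ∑ j, c j * g j x) x = ∑ j, c j * mderiv γ (g j) x := by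
  obtain ⟨v, hv⟩ := exists_mderiv_eq γ rfl
  have hc : ∀ j, ContDiff ℝ (∑ i, γ i : ℕ) fun x => c j * g j x :=
    fun j => contDiff_const.mul (hg j)
  rw [hv _ (ContDiff.sum fun j _ => hc j), iteratedFDeriv_sum fun j _ => hc j, Finset.sum_apply,
    sum_apply]
  refine Finset.sum_congr rfl fun j _ => ?_
  have := iteratedFDeriv_const_smul_apply (a := c j) ((hg j).contDiffAt (x := x))
  rw [hv _ (hg j)]
  change iteratedFDeriv ℝ _ (c j • g j) x _ = _
  rw [this]
  rfl

theorem pderiv1_prod {u : Fin d → ℝ → ℝ} (hu : ∀ j, Differentiable ℝ (u j)) (i : Fin d) :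
    pderiv1 i (fun x => ∏ j, u j (x j)) =
      fun x => ∏ j, Function.update u i (deriv (u i)) j (x j) := by
  funext x
  have h : HasFDerivAt (fun x : Fin d → ℝ => ∏ j, u j (x j))
      (∑ j, (∏ k ∈ Finset.univ.erase j, u k (x k)) •
        (deriv (u j) (x j) • (ContinuousLinearMap.proj j : (Fin d → ℝ) →L[ℝ] ℝ))) x :=
    HasFDerivAt.finsetProd fun j _ =>
      ((hu j (x j)).hasDerivAt).comp_hasFDerivAt x (hasFDerivAt_apply j x)
  rw [pderiv1, h.fderiv, sum_apply, Finset.sum_eq_single i]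
  · rw [← Finset.mul_prod_erase _ _ (Finset.mem_univ i), Function.update_self]
    simp only [smul_apply, ContinuousLinearMap.proj_apply, Pi.single_eq_same,
      smul_eq_mul, mul_one]
    rw [mul_comm]
    congr 1
    refine Finset.prod_congr rfl fun j hj => ?_
    rw [Function.update_of_ne (Finset.ne_of_mem_erase hj)]
  · intro j _ hj
    simp [hj]
  · simp

theorem iterate_pderiv1_prod {u : Fin d → ℝ → ℝ} (hu : ∀ j, ContDiff ℝ (⊤ : ℕ∞) (u j)) (i : Fin d)
    (n : ℕ) : (pderiv1 i)^[n] (fun x => ∏ j, u j (x j)) =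
      fun x => ∏ j, Function.update u i (iteratedDeriv n (u i)) j (x j) := by
  induction n with
  | zero => simp
  | succ n ih =>
    have hd : ∀ j, Differentiable ℝ (Function.update u i (iteratedDeriv n (u i)) j) := by
      intro j
      by_cases hj : j = i
      · subst hj
        rw [Function.update_self]
        exact (hu j).differentiable_iteratedDeriv n (by exact_mod_cast WithTop.coe_lt_top n)
      · rw [Function.update_of_ne hj]
        exact (hu j).differentiable (by simp)
    rw [Function.iterate_succ_apply', ih, pderiv1_prod hd, Function.update_idem,
      Function.update_self, iteratedDeriv_succ]

theorem mderiv_prod {u : Fin d → ℝ → ℝ} (hu : ∀ j, ContDiff ℝ (⊤ : ℕ∞) (u j)) (γ : Fin d → ℕ)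
    (x : Fin d → ℝ) :
    mderiv γ (fun x => ∏ j, u j (x j)) x = ∏ j, iteratedDeriv (γ j) (u j) (x j) := by
  have key : ∀ l : List (Fin d), l.Nodup →
      l.foldr (fun i h => (pderiv1 i)^[γ i] h) (fun x => ∏ j, u j (x j)) =
        fun x => ∏ j, (if j ∈ l then iteratedDeriv (γ j) (u j) else u j) (x j) := by
    intro l hl
    induction l with
    | nil => simp
    | cons i l ih =>
      obtain ⟨hi, hl⟩ := List.nodup_cons.1 hl
      rw [List.foldr_cons, ih hl, iterate_pderiv1_prod]
      · funext x
        refine Finset.prod_congr rfl fun j _ => ?_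
        by_cases hj : j = i
        · subst hj; simp [hi]
        · simp [hj]
      · intro j
        split_ifs
        · rw [iteratedDeriv_eq_iterate]
          exact (hu j).iterate_deriv (γ j)
        · exact hu j
  rw [mderiv, key _ (List.nodup_finRange d)]
  simp

end pderivs

/-- Taylor remainder estimate along a segment, in terms of the top order derivative. -/
theorem norm_iteratedFDeriv_segment_le {E : Type*} [NormedAddCommGroup E] [NormedSpace ℝ E]
    {R : E → ℝ} {s : ℕ} (hR : ContDiff ℝ s R) {a y : E} {Λ : ℝ}
    (h0 : ∀ n < s, iteratedFDeriv ℝ n R a = 0)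
    (hΛ : ∀ t ∈ Set.Icc (0 : ℝ) 1, ‖iteratedFDeriv ℝ s R (a + t • (y - a))‖ ≤ Λ) (e : ℕ) :
    ∀ n, n + e = s → ∀ t ∈ Set.Icc (0 : ℝ) 1,
      ‖iteratedFDeriv ℝ n R (a + t • (y - a))‖ ≤ Λ * (‖y - a‖ * t) ^ e / e.factorial := by
  induction e with
  | zero =>
    rintro n rfl t ht
    simpa using hΛ t ht
  | succ e ih =>
    intro n hn
    have hdiff : Differentiable ℝ (iteratedFDeriv ℝ n R) :=
      hR.differentiable_iteratedFDeriv (by norm_cast; omega)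
    have hline : ∀ t : ℝ, HasDerivAt (fun t : ℝ => a + t • (y - a)) (y - a) t := fun t => by
      simpa using ((hasDerivAt_id t).smul_const (y - a)).const_add a
    have hφ : ∀ t : ℝ, HasDerivAt (fun t : ℝ => iteratedFDeriv ℝ n R (a + t • (y - a)))
        (fderiv ℝ (iteratedFDeriv ℝ n R) (a + t • (y - a)) (y - a)) t := fun t =>
      (hdiff _).hasFDerivAt.comp_hasDerivAt t (hline t)
    have hB : ∀ t : ℝ, HasDerivAt (fun t : ℝ => Λ * (‖y - a‖ * t) ^ (e + 1) / (e + 1).factorial)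
        (Λ * (‖y - a‖ * t) ^ e / e.factorial * ‖y - a‖) t := fun t => by
      have h1 := ((((hasDerivAt_id t).const_mul ‖y - a‖).pow (e + 1)).const_mul Λ).div_const
        ((e + 1).factorial : ℝ)
      refine h1.congr_deriv ?_
      rw [Nat.factorial_succ]
      push_cast
      simp only [id, mul_one]
      field_simp
    refine fun t ht => image_norm_le_of_norm_deriv_right_le_deriv_boundary
      (fun t _ => (hφ t).continuousAt.continuousWithinAt) (fun t _ => (hφ t).hasDerivWithinAt)
      ?_ hB (fun t ht => ?_) ht
    · simp [h0 n (by omega)]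
    · refine (ContinuousLinearMap.le_opNorm _ _).trans ?_
      rw [norm_fderiv_iteratedFDeriv]
      exact mul_le_mul_of_nonneg_right (ih (n + 1) (by omega) t ⟨ht.1, ht.2.le⟩) (norm_nonneg _)

theorem iteratedDeriv_sub_pow (a : ℝ) (n k : ℕ) (y : ℝ) :
    iteratedDeriv k (fun t : ℝ => (t - a) ^ n) y = n.descFactorial k * (y - a) ^ (n - k) := by
  have := congrFun (iteratedDeriv_comp_sub_const k (fun t : ℝ => t ^ n) a) y
  rw [this, iteratedDeriv_pow]

section taylor

variable {d : ℕ}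

/-- The coefficients of the Taylor polynomial of degree `s`. -/
noncomputable def taylorCoeff (s : ℕ) (f : (Fin d → ℝ) → ℝ) (a : Fin d → ℝ)
    (γ : Fin d → Fin (s + 1)) : ℝ :=
  if ∑ i, (γ i : ℕ) ≤ s then mderiv (fun i => (γ i : ℕ)) f a / ∏ i, ((γ i : ℕ).factorial : ℝ) else 0

/-- The Taylor polynomial of degree `s` at `a`. -/
noncomputable def taylorPoly (s : ℕ) (f : (Fin d → ℝ) → ℝ) (a x : Fin d → ℝ) : ℝ :=
  ∑ γ : Fin d → Fin (s + 1), taylorCoeff s f a γ * ∏ i, (x i - a i) ^ (γ i : ℕ)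

theorem abs_taylorCoeff_le {s : ℕ} {f : (Fin d → ℝ) → ℝ} {a : Fin d → ℝ} {H : ℝ} (hH : 0 ≤ H)
    (h : ∀ γ : Fin d → ℕ, ∑ i, γ i ≤ s → |mderiv γ f a| ≤ H) (γ : Fin d → Fin (s + 1)) :
    |taylorCoeff s f a γ| ≤ H := by
  unfold taylorCoeff
  split_ifs with hγ
  · rw [abs_div, Finset.abs_prod]
    refine div_le_of_le_mul₀ (by positivity) hH ((h _ hγ).trans (le_mul_of_one_le_right hH ?_))
    refine Finset.prod_induction _ (fun t : ℝ => 1 ≤ t) (fun _ _ => one_le_mul_of_one_le_of_one_le)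
      le_rfl fun i _ => ?_
    rw [Nat.abs_cast]
    exact_mod_cast Nat.one_le_iff_ne_zero.2 (Nat.factorial_ne_zero _)
  · simpa using hH

theorem contDiff_taylorPoly (s : ℕ) (f : (Fin d → ℝ) → ℝ) (a : Fin d → ℝ) {n : WithTop ℕ∞} :
    ContDiff ℝ n (taylorPoly s f a) := by
  unfold taylorPoly
  fun_prop

theorem mderiv_taylorPoly {s : ℕ} (f : (Fin d → ℝ) → ℝ) (a y : Fin d → ℝ) {α : Fin d → ℕ}
    (hα : ∑ i, α i ≤ s) (h : ∑ i, α i = s ∨ y = a) :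
    mderiv α (taylorPoly s f a) y = mderiv α f a := by
  have hα' : ∀ i, α i < s + 1 := fun i =>
    Nat.lt_succ_of_le ((Finset.single_le_sum (fun _ _ => Nat.zero_le _) (Finset.mem_univ i)).trans hα)
  unfold taylorPoly
  rw [mderiv_sum_mul α (g := fun (γ : Fin d → Fin (s + 1)) x => ∏ i, (x i - a i) ^ (γ i : ℕ))
    (fun γ => by fun_prop) (taylorCoeff s f a),
    Finset.sum_eq_single fun i => (⟨α i, hα' i⟩ : Fin (s + 1))]
  · rw [mderiv_prod (u := fun i t => (t - a i) ^ α i) (fun j => by fun_prop)]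
    simp only [taylorCoeff, hα, if_true, iteratedDeriv_sub_pow, Nat.descFactorial_self, Nat.sub_self,
      pow_zero, mul_one]
    exact div_mul_cancel₀ _ (Finset.prod_ne_zero_iff.2 fun i _ => by positivity)
  · intro γ _ hγ
    rw [mderiv_prod (u := fun i t => (t - a i) ^ (γ i : ℕ)) (fun j => by fun_prop)]
    simp only [iteratedDeriv_sub_pow]
    by_cases hlt : ∃ i, (γ i : ℕ) < α i
    · obtain ⟨i, hi⟩ := hlt
      rw [Finset.prod_eq_zero (Finset.mem_univ i), mul_zero]
      rw [Nat.descFactorial_of_lt hi, Nat.cast_zero, zero_mul]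
    · push Not at hlt
      obtain ⟨i, hi⟩ : ∃ i, α i < (γ i : ℕ) := by
        by_contra! hcon
        exact hγ (funext fun i => Fin.ext (le_antisymm (hcon i) (hlt i)))
      rcases h with h | rfl
      · have : ∑ i, α i < ∑ i, (γ i : ℕ) :=
          Finset.sum_lt_sum (fun i _ => hlt i) ⟨i, Finset.mem_univ i, hi⟩
        rw [taylorCoeff, if_neg (by omega), zero_mul]
      · rw [Finset.prod_eq_zero (Finset.mem_univ i), mul_zero]
        rw [sub_self, zero_pow (by omega), mul_zero]
  · simp

theorem norm_iteratedFDeriv_taylor_remainder_le {s : ℕ} {f : (Fin d → ℝ) → ℝ}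
    (hf : ContDiff ℝ s f) {a y : Fin d → ℝ} {B : ℝ}
    (hB : ∀ t ∈ Set.Icc (0 : ℝ) 1, ∀ γ : Fin d → ℕ, ∑ i, γ i = s →
      |mderiv γ f (a + t • (y - a)) - mderiv γ f a| ≤ B) {n : ℕ} (hn : n ≤ s) :
    ‖iteratedFDeriv ℝ n (fun x => f x - taylorPoly s f a x) y‖ ≤
      d ^ s * B * ‖y - a‖ ^ (s - n) / (s - n).factorial := by
  have hP : ContDiff ℝ s (taylorPoly s f a) := contDiff_taylorPoly s f a
  have hsub : ∀ n ≤ s, ∀ x, iteratedFDeriv ℝ n (fun x => f x - taylorPoly s f a x) x =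
      iteratedFDeriv ℝ n f x - iteratedFDeriv ℝ n (taylorPoly s f a) x := fun n hn x =>
    iteratedFDeriv_sub_apply ((hf.of_le (by exact_mod_cast hn)).contDiffAt)
      ((hP.of_le (by exact_mod_cast hn)).contDiffAt)
  have h := norm_iteratedFDeriv_segment_le (hf.sub hP) (a := a) (y := y) (Λ := d ^ s * B) ?_ ?_
    (s - n) n (by omega) 1 (by simp)
  · simpa using h
  · intro n hn
    rw [hsub n hn.le, sub_eq_zero]
    refine iteratedFDeriv_eq_of_mderiv_eq (hf.of_le (by exact_mod_cast hn.le))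
      (hP.of_le (by exact_mod_cast hn.le)) fun γ hγ => ?_
    exact (mderiv_taylorPoly f a a (by omega) (Or.inr rfl)).symm
  · intro t ht
    rw [hsub s le_rfl, iteratedFDeriv_eq_of_mderiv_eq hP hf (y := a) fun γ hγ =>
      mderiv_taylorPoly f a _ hγ.le (Or.inl hγ)]
    exact norm_iteratedFDeriv_sub_le hf (hB t ht)

end taylor

section partition

variable {d : ℕ}

theorem norm_iteratedFDeriv_comp_apply_le {n : ℕ} {u : ℝ → ℝ} (hu : ContDiff ℝ n u) (i : Fin d)
    (x : Fin d → ℝ) {k : ℕ} (hk : k ≤ n) :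
    ‖iteratedFDeriv ℝ k (fun x : Fin d → ℝ => u (x i)) x‖ ≤ |iteratedDeriv k u (x i)| := by
  have h := (ContinuousLinearMap.proj i : (Fin d → ℝ) →L[ℝ] ℝ).iteratedFDeriv_comp_right hu x
    (i := k) (by exact_mod_cast hk)
  change ‖iteratedFDeriv ℝ k (u ∘ (ContinuousLinearMap.proj i : (Fin d → ℝ) →L[ℝ] ℝ)) x‖ ≤ _
  rw [h, ← Real.norm_eq_abs, ← norm_iteratedFDeriv_eq_norm_iteratedDeriv]
  refine (ContinuousMultilinearMap.norm_compContinuousLinearMap_le _ _).trans ?_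
  refine mul_le_of_le_one_right (norm_nonneg _) (Finset.prod_le_one (fun _ _ => norm_nonneg _)
    fun _ _ => ContinuousLinearMap.opNorm_le_bound _ zero_le_one fun y => ?_)
  simpa using norm_le_pi_norm y i

/-- Derivatives of a product of univariate functions in separate variables. -/
theorem norm_iteratedFDeriv_prod_apply_le {n : ℕ} {u : Fin d → ℝ → ℝ}
    (hu : ∀ i, ContDiff ℝ n (u i)) {x : Fin d → ℝ} {F : Fin d → ℝ} {D : ℝ}
    (h : ∀ i, ∀ k ≤ n, |iteratedDeriv k (u i) (x i)| ≤ F i * D ^ k) :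
    ‖iteratedFDeriv ℝ n (fun x => ∏ i, u i (x i)) x‖ ≤ (∏ i, F i) * (d * D) ^ n := by
  refine (norm_iteratedFDeriv_prod_le (f := fun i (x : Fin d → ℝ) => u i (x i)) (N := n)
    (fun i _ => (hu i).comp (contDiff_apply ℝ ℝ i)) le_rfl).trans ?_
  have hd : (d * D : ℝ) = ∑ _i : Fin d, D := by simp
  rw [hd, Finset.sum_pow, Finset.mul_sum]
  refine Finset.sum_le_sum fun p _ => ?_
  rw [mul_left_comm]
  refine mul_le_mul_of_nonneg_left ?_ (Nat.cast_nonneg _)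
  have hcount : ∀ i, (p : Multiset (Fin d)).count i ≤ n := fun i =>
    (Multiset.count_le_card _ _).trans_eq p.2
  have hprod : ((p : Multiset (Fin d)).map fun _ => D).prod =
      ∏ i, D ^ (p : Multiset (Fin d)).count i :=
    Finset.prod_multiset_map_count _ _ |>.trans
      (Finset.prod_subset (Finset.subset_univ _) fun i _ hi => by
        rw [Multiset.mem_toFinset] at hi
        rw [Multiset.count_eq_zero_of_notMem hi, pow_zero])
  change _ ≤ _ * ((p : Multiset (Fin d)).map fun _ => D).prod
  rw [hprod, ← Finset.prod_mul_distrib]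
  exact Finset.prod_le_prod (fun _ _ => norm_nonneg _) fun i _ =>
    (norm_iteratedFDeriv_comp_apply_le (hu i) i x (hcount i)).trans (h i _ (hcount i))

/-- The product partition of unity on the grid of mesh `1 / M`. -/
noncomputable def gridBump (q M : ℕ) (m : Fin d → Fin (M + 1)) (x : Fin d → ℝ) : ℝ :=
  ∏ i, bump q M (m i) (x i)

/-- The grid points with spacing `1 / M`. -/
noncomputable def gridPoint (M : ℕ) (m : Fin d → Fin (M + 1)) : Fin d → ℝ :=
  fun i => ((m i : ℕ) : ℝ) / (M : ℝ)

theorem contDiff_gridBump (s M : ℕ) (m : Fin d → Fin (M + 1)) :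
    ContDiff ℝ s (gridBump (s + 1) M m) := by
  unfold gridBump
  exact contDiff_prod fun i _ => (contDiff_bump s M (m i)).comp (contDiff_apply ℝ ℝ i)

theorem norm_iteratedFDeriv_gridBump_le {s k : ℕ} (hk : k ≤ s) (M : ℕ) (m : Fin d → Fin (M + 1))
    (x : Fin d → ℝ) :
    ‖iteratedFDeriv ℝ k (gridBump (s + 1) M m) x‖ ≤
      (2 * 6 ^ (s + 1)) ^ d * (d * (((s + 1 : ℕ) : ℝ) * (max M 1 : ℕ))) ^ k := by
  have h := norm_iteratedFDeriv_prod_apply_le (n := k) (u := fun i => bump (s + 1) M (m i)) (x := x)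
    (F := fun _ => 2 * 6 ^ (s + 1)) (D := ((s + 1 : ℕ) : ℝ) * (max M 1 : ℕ))
    (fun i => (contDiff_bump s M (m i)).of_le (by exact_mod_cast hk))
    (fun i j hj => abs_iteratedDeriv_bump_le (hj.trans hk) (x i))
  rwa [Finset.prod_const, Finset.card_univ, Fintype.card_fin] at h

theorem iteratedFDeriv_gridBump_eq_zero {s k : ℕ} (hk : k ≤ s) {M : ℕ} {m : Fin d → Fin (M + 1)}
    {x : Fin d → ℝ} (hx : x ∈ cube d) {i : Fin d}
    (hi : ((max M 1 : ℕ) : ℝ)⁻¹ < |x i - gridPoint M m i|) :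
    iteratedFDeriv ℝ k (gridBump (s + 1) M m) x = 0 := by
  have h := norm_iteratedFDeriv_prod_apply_le (n := k) (u := fun i => bump (s + 1) M (m i)) (x := x)
    (F := fun j => if j = i then 0 else 2 * 6 ^ (s + 1)) (D := ((s + 1 : ℕ) : ℝ) * (max M 1 : ℕ))
    (fun i => (contDiff_bump s M (m i)).of_le (by exact_mod_cast hk))
    (fun j l hl => by
      split_ifs with hj
      · subst hj
        rw [iteratedDeriv_bump_eq_zero (hl.trans hk) (Nat.lt_succ_iff.1 (m j).2)
          ⟨hx.1 j, hx.2 j⟩ hi]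
        simp
      · exact abs_iteratedDeriv_bump_le (hl.trans hk) (x j))
  have h0 : ∏ j : Fin d, (if j = i then (0 : ℝ) else 2 * 6 ^ (s + 1)) = 0 :=
    Finset.prod_eq_zero (Finset.mem_univ i) (if_pos rfl)
  rw [h0, zero_mul] at h
  exact norm_le_zero_iff.1 h

theorem sum_gridBump (q M : ℕ) (x : Fin d → ℝ) : ∑ m, gridBump q M m x = 1 := by
  unfold gridBump
  rw [← Fintype.prod_sum fun (i : Fin d) (l : Fin (M + 1)) => bump q M l (x i)]
  simp [sum_bump]

theorem gridPoint_mem_cube (M : ℕ) (m : Fin d → Fin (M + 1)) : gridPoint M m ∈ cube d := by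
  refine ⟨fun i => ?_, fun i => ?_⟩
  · simp only [gridPoint, Pi.zero_apply]; positivity
  · exact div_le_one_of_le₀ (Nat.cast_le.2 (Nat.lt_succ_iff.1 (m i).2)) (Nat.cast_nonneg _)

theorem card_near_gridPoint_le (M : ℕ) (x : Fin d → ℝ) :
    (Finset.univ.filter fun m : Fin d → Fin (M + 1) =>
      ∀ i, |x i - gridPoint M m i| ≤ ((max M 1 : ℕ) : ℝ)⁻¹).card ≤ 3 ^ d := by
  have h : (Finset.univ.filter fun m : Fin d → Fin (M + 1) =>
      ∀ i, |x i - gridPoint M m i| ≤ ((max M 1 : ℕ) : ℝ)⁻¹) =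
      Fintype.piFinset fun i => Finset.univ.filter fun l : Fin (M + 1) =>
        |x i - (l : ℕ) / (M : ℝ)| ≤ ((max M 1 : ℕ) : ℝ)⁻¹ := by
    ext m
    simp [Fintype.mem_piFinset, gridPoint]
  rw [h, Fintype.card_piFinset]
  refine (Finset.prod_le_prod' fun i _ => card_near_le M (x i)).trans ?_
  simp

theorem eucDist_le {x y : Fin d → ℝ} : eucDist x y ≤ d * ‖x - y‖ := by
  refine Real.sqrt_le_iff.2 ⟨by positivity, ?_⟩
  calc ∑ i, (x i - y i) ^ 2 ≤ ∑ _i : Fin d, ‖x - y‖ ^ 2 := by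
        refine Finset.sum_le_sum fun i _ => ?_
        rw [← sq_abs, ← Real.norm_eq_abs]
        exact pow_le_pow_left₀ (norm_nonneg _) (norm_le_pi_norm (x - y) i) 2
    _ = d * ‖x - y‖ ^ 2 := by simp
    _ ≤ (d * ‖x - y‖) ^ 2 := by
        rw [mul_pow]
        refine mul_le_mul_of_nonneg_right ?_ (by positivity)
        exact_mod_cast Nat.le_self_pow two_ne_zero d

theorem norm_sub_le_eucDist (x y : Fin d → ℝ) : ‖x - y‖ ≤ eucDist x y := by
  refine (pi_norm_le_iff_of_nonneg (Real.sqrt_nonneg _)).2 fun i => Real.le_sqrt_of_sq_le ?_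
  rw [Real.norm_eq_abs, sq_abs]
  exact Finset.single_le_sum (f := fun i => (x i - y i) ^ 2) (fun i _ => sq_nonneg _)
    (Finset.mem_univ i)

theorem lfloor_lt {β : ℝ} (hβ : 0 < β) : (lfloor β : ℝ) < β := by
  have h := Nat.ceil_pos.2 hβ
  have h1 : lfloor β < ⌈β⌉₊ := Nat.sub_lt h one_pos
  exact Nat.lt_ceil.1 h1

theorem le_lfloor_add_one (β : ℝ) : β ≤ lfloor β + 1 := by
  have h : ⌈β⌉₊ ≤ lfloor β + 1 := by unfold lfloor; omega
  exact_mod_cast Nat.ceil_le.1 h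

theorem MemHolderBall1.abs_mderiv_sub_le {β H ρ : ℝ} (hβ : 0 < β) (hd : 0 < d) (hH : 0 ≤ H)
    {f : (Fin d → ℝ) → ℝ} (hf : MemHolderBall1 β H f) {a y : Fin d → ℝ} (ha : a ∈ cube d)
    (hy : y ∈ cube d) (hρ : ‖y - a‖ ≤ ρ) {γ : Fin d → ℕ} (hγ : ∑ i, γ i = lfloor β) :
    |mderiv γ f y - mderiv γ f a| ≤ d * H * ρ ^ (β - lfloor β) := by
  have hρ0 : 0 ≤ ρ := (norm_nonneg _).trans hρ
  have hδ := (sub_pos.2 (lfloor_lt hβ)).le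
  have hd1 : (1 : ℝ) ≤ d := by exact_mod_cast hd
  by_cases hya : y = a
  · subst hya
    rw [sub_self, abs_zero]
    positivity
  · refine (hf.2.2 γ hγ y hy a ha hya).trans ?_
    have he : 0 ≤ eucDist y a := Real.sqrt_nonneg _
    calc H * min 1 (eucDist y a) ^ (β - lfloor β) ≤ H * (d * ρ) ^ (β - lfloor β) := by
          gcongr
          exact (min_le_right _ _).trans (eucDist_le.trans (by gcongr))
      _ ≤ H * (d * ρ ^ (β - lfloor β)) := by
          rw [Real.mul_rpow (by positivity) hρ0]
          gcongr
          have := le_lfloor_add_one β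
          exact (Real.rpow_le_rpow_of_exponent_le hd1 (by linarith)).trans_eq (Real.rpow_one _)
      _ = _ := by ring

end partition

theorem pow_div_factorial_le_three_pow (q e : ℕ) : (q : ℝ) ^ e / e.factorial ≤ 3 ^ q := by
  refine (Real.pow_div_factorial_le_exp (q : ℝ) (Nat.cast_nonneg _) e).trans ?_
  rw [← Real.exp_one_pow]
  gcongr
  exact Real.exp_one_lt_three.le

theorem mesh_power_le {s N K n k : ℕ} {β : ℝ} (hs : (s : ℝ) ≤ β) (hs' : β ≤ s + 1) (hN : 0 < N)
    (hK : 0 < K) (hKN : K ≤ 3 * (N * (s + 1))) (hk : k ≤ n) (hn : n ≤ s) :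
    (((s + 1 : ℕ) : ℝ) * N) ^ k * ((N : ℝ)⁻¹ ^ (β - s) * (N : ℝ)⁻¹ ^ (s - (n - k)) /
      (s - (n - k)).factorial) ≤ 3 ^ β * (s + 1 : ℕ) * 3 ^ (s + 1) * (K : ℝ) ^ (n - β) := by
  obtain ⟨e, he⟩ : ∃ e, e = s - (n - k) := ⟨_, rfl⟩
  obtain ⟨q, hq⟩ : ∃ q, q = s + 1 := ⟨_, rfl⟩
  rw [← he, ← hq]
  rw [← hq] at hKN
  have hq0 : (0 : ℝ) < q := by rw [hq]; positivity
  have hq1 : (1 : ℝ) ≤ q := by rw [hq]; push_cast; linarith [(Nat.cast_nonneg s : (0 : ℝ) ≤ s)]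
  have hN0 : (0 : ℝ) < N := by exact_mod_cast hN
  have hK0 : (0 : ℝ) < K := by exact_mod_cast hK
  have hη : ((q : ℝ) * N)⁻¹ ≤ 3 / K := by
    rw [inv_le_comm₀ (by positivity) (by positivity), inv_div, div_le_iff₀ (by norm_num)]
    have : (K : ℝ) ≤ 3 * (N * q) := by exact_mod_cast hKN
    linarith
  have hnk : n - k ≤ s := by omega
  have hNinv : (N : ℝ)⁻¹ = q * ((q : ℝ) * N)⁻¹ := by field_simp
  obtain ⟨η, hηd⟩ : ∃ η, η = ((q : ℝ) * N)⁻¹ := ⟨_, rfl⟩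
  have hη0 : 0 < η := by rw [hηd]; positivity
  have hqN : (q : ℝ) * N = η⁻¹ := by rw [hηd, inv_inv]
  rw [hNinv, ← hηd, hqN]
  rw [← hηd] at hη
  have h1 : (η⁻¹) ^ k * ((q * η) ^ (β - s) * (q * η) ^ e / e.factorial) =
      (q ^ e / e.factorial) * (q : ℝ) ^ (β - s) * η ^ (β - n) := by
    rw [Real.mul_rpow hq0.le hη0.le, mul_pow]
    have : η ^ (β - n) = η ^ (β - s) * η ^ e * (η⁻¹) ^ k := by
      rw [inv_pow, ← Real.rpow_natCast, ← Real.rpow_natCast, ← Real.rpow_neg hη0.le,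
        ← Real.rpow_add hη0, ← Real.rpow_add hη0]
      congr 1
      rw [he, Nat.cast_sub hnk, Nat.cast_sub hk]
      ring
    rw [this]
    ring
  have hnβ : (n : ℝ) ≤ s := by exact_mod_cast hn
  calc _ = (q ^ e / e.factorial) * (q : ℝ) ^ (β - s) * η ^ (β - n) := h1
    _ ≤ 3 ^ q * q * (3 / K) ^ (β - n) := by
        gcongr
        · exact pow_div_factorial_le_three_pow q e
        · exact (Real.rpow_le_rpow_of_exponent_le hq1 (by linarith)).trans_eq (Real.rpow_one _)
        · linarith
    _ ≤ 3 ^ q * q * (3 ^ β * (K : ℝ) ^ (n - β)) := by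
        rw [Real.div_rpow (by norm_num) hK0.le, div_eq_mul_inv, ← Real.rpow_neg hK0.le, neg_sub]
        gcongr
        · norm_num
        · linarith [(Nat.cast_nonneg n : (0 : ℝ) ≤ n)]
    _ = _ := by ring

section localTaylor

variable {d : ℕ}

/-- The local Taylor polynomials of `f` at the grid points, glued by the partition of unity. -/
noncomputable def localTaylor (s M : ℕ) (f : (Fin d → ℝ) → ℝ) (x : Fin d → ℝ) : ℝ :=
  ∑ m, gridBump (s + 1) M m x * taylorPoly s f (gridPoint M m) x

theorem contDiff_localTaylor (s M : ℕ) (f : (Fin d → ℝ) → ℝ) : ContDiff ℝ s (localTaylor s M f) :=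
  ContDiff.sum fun m _ => (contDiff_gridBump s M m).mul (contDiff_taylorPoly s f _)

theorem MemHolderBall1.contDiff {β H : ℝ} {f : (Fin d → ℝ) → ℝ} (hf : MemHolderBall1 β H f) :
    ContDiff ℝ (lfloor β) f := by
  simpa using hf.1

theorem MemHolderBall1.norm_iteratedFDeriv_gridBump_mul_le {β H : ℝ} (hβ : 0 < β) (hd : 0 < d)
    (hH : 0 ≤ H) {f : (Fin d → ℝ) → ℝ} (hf : MemHolderBall1 β H f) {M K n : ℕ} (hK : 0 < K)
    (hKM : K ≤ 3 * (max M 1 * (lfloor β + 1))) (hn : n ≤ lfloor β) {x : Fin d → ℝ}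
    (hx : x ∈ cube d) {m : Fin d → Fin (M + 1)}
    (hm : ∀ i, |x i - gridPoint M m i| ≤ ((max M 1 : ℕ) : ℝ)⁻¹) :
    ‖iteratedFDeriv ℝ n (fun x => gridBump (lfloor β + 1) M m x *
      (f x - taylorPoly (lfloor β) f (gridPoint M m) x)) x‖ ≤
      (2 * 6 ^ (lfloor β + 1)) ^ d * d ^ (lfloor β + 1) * H * (2 * d) ^ n *
        (3 ^ β * (lfloor β + 1 : ℕ) * 3 ^ (lfloor β + 1) * (K : ℝ) ^ (n - β)) := by
  have hlt := lfloor_lt hβ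
  have hle := le_lfloor_add_one β
  have hcf := hf.contDiff
  have hB : ∀ t ∈ Set.Icc (0 : ℝ) 1, ∀ γ : Fin d → ℕ, ∑ i, γ i = lfloor β →
      |mderiv γ f (gridPoint M m + t • (x - gridPoint M m)) - mderiv γ f (gridPoint M m)| ≤
        d * H * ((max M 1 : ℕ) : ℝ)⁻¹ ^ (β - lfloor β) := by
    intro t ht γ hγ
    refine hf.abs_mderiv_sub_le hβ hd hH (gridPoint_mem_cube M m) ?_ ?_ hγ
    · exact (convex_Icc (0 : Fin d → ℝ) 1).add_smul_sub_mem (gridPoint_mem_cube M m) hx ht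
    · rw [add_sub_cancel_left, norm_smul, Real.norm_of_nonneg ht.1]
      refine (mul_le_of_le_one_left (norm_nonneg _) ht.2).trans ?_
      exact (pi_norm_le_iff_of_nonneg (by positivity)).2 hm
  have hR : ∀ j ≤ lfloor β, ‖iteratedFDeriv ℝ j
      (fun x => f x - taylorPoly (lfloor β) f (gridPoint M m) x) x‖ ≤
        d ^ (lfloor β) * (d * H * ((max M 1 : ℕ) : ℝ)⁻¹ ^ (β - lfloor β)) *
          ((max M 1 : ℕ) : ℝ)⁻¹ ^ (lfloor β - j) / (lfloor β - j).factorial := by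
    intro j hj
    refine (norm_iteratedFDeriv_taylor_remainder_le hcf hB hj).trans ?_
    gcongr
    exact (pi_norm_le_iff_of_nonneg (by positivity)).2 hm
  have hd1 : (1 : ℝ) ≤ d := by exact_mod_cast hd
  have hN0 : 0 < max M 1 := by omega
  generalize lfloor β = s at *
  generalize hN : max M 1 = N at *
  refine (norm_iteratedFDeriv_mul_le (contDiff_gridBump s M m)
    (hcf.sub (contDiff_taylorPoly s f _)) x (by exact_mod_cast hn)).trans ?_
  calc _ ≤ ∑ k ∈ Finset.range (n + 1), (n.choose k : ℝ) * ((2 * 6 ^ (s + 1)) ^ d *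
        d ^ (s + 1) * H * d ^ n *
        (3 ^ β * (s + 1 : ℕ) * 3 ^ (s + 1) * (K : ℝ) ^ (n - β))) := by
        refine Finset.sum_le_sum fun k hk => ?_
        have hkn : k ≤ n := Nat.lt_succ_iff.1 (Finset.mem_range.1 hk)
        rw [mul_assoc]
        refine mul_le_mul_of_nonneg_left ?_ (Nat.cast_nonneg _)
        have h1 := norm_iteratedFDeriv_gridBump_le (hkn.trans hn) M m x
        rw [hN] at h1
        refine (mul_le_mul h1 (hR (n - k) ((Nat.sub_le _ _).trans hn)) (norm_nonneg _)
          (by positivity)).trans ?_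
        have h2 := mesh_power_le hlt.le hle hN0 hK hKM hkn hn
        have h3 : (d : ℝ) ^ k ≤ d ^ n := pow_le_pow_right₀ hd1 hkn
        calc _ = (2 * 6 ^ (s + 1)) ^ d * d ^ (s + 1) * H * d ^ k *
              ((((s + 1 : ℕ) : ℝ) * N) ^ k * ((N : ℝ)⁻¹ ^ (β - s) * (N : ℝ)⁻¹ ^ (s - (n - k)) /
                (s - (n - k)).factorial)) := by
              rw [mul_pow (d : ℝ)]
              ring
          _ ≤ _ := by gcongr
    _ = _ := by
        rw [← Finset.sum_mul]
        have : ∑ k ∈ Finset.range (n + 1), (n.choose k : ℝ) = 2 ^ n := by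
          exact_mod_cast Nat.sum_range_choose n
        rw [this, mul_pow 2]
        ring

/-- Local Taylor approximation of a Hölder function, together with all derivatives. -/
theorem MemHolderBall1.norm_iteratedFDeriv_sub_localTaylor_le {β H : ℝ} (hβ : 0 < β) (hd : 0 < d)
    (hH : 0 ≤ H) {f : (Fin d → ℝ) → ℝ} (hf : MemHolderBall1 β H f) {M K n : ℕ} (hK : 0 < K)
    (hKM : K ≤ 3 * (max M 1 * (lfloor β + 1))) (hn : n ≤ lfloor β) {x : Fin d → ℝ}
    (hx : x ∈ cube d) :
    ‖iteratedFDeriv ℝ n (fun x => f x - localTaylor (lfloor β) M f x) x‖ ≤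
      3 ^ d * ((2 * 6 ^ (lfloor β + 1)) ^ d * d ^ (lfloor β + 1) * H * (2 * d) ^ n *
        (3 ^ β * (lfloor β + 1 : ℕ) * 3 ^ (lfloor β + 1) * (K : ℝ) ^ (n - β))) := by
  have heq : (fun x => f x - localTaylor (lfloor β) M f x) = fun x =>
      ∑ m, gridBump (lfloor β + 1) M m x *
        (f x - taylorPoly (lfloor β) f (gridPoint M m) x) := by
    funext x
    simp only [localTaylor, mul_sub, Finset.sum_sub_distrib]
    rw [← Finset.sum_mul, sum_gridBump, one_mul]
  have hcR : ∀ m : Fin d → Fin (M + 1), ContDiff ℝ (lfloor β)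
      fun x => f x - taylorPoly (lfloor β) f (gridPoint M m) x :=
    fun m => hf.contDiff.sub (contDiff_taylorPoly _ f _)
  have hc : ∀ m : Fin d → Fin (M + 1), ContDiff ℝ n fun x => gridBump (lfloor β + 1) M m x *
      (f x - taylorPoly (lfloor β) f (gridPoint M m) x) := fun m =>
    ((contDiff_gridBump _ M m).mul (hcR m)).of_le (by exact_mod_cast hn)
  have hfar : ∀ m : Fin d → Fin (M + 1),
      (¬ ∀ i, |x i - gridPoint M m i| ≤ ((max M 1 : ℕ) : ℝ)⁻¹) →
      ‖iteratedFDeriv ℝ n (fun x => gridBump (lfloor β + 1) M m x *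
        (f x - taylorPoly (lfloor β) f (gridPoint M m) x)) x‖ = 0 := by
    intro m hm
    push Not at hm
    obtain ⟨i, hi⟩ := hm
    refine le_antisymm ((norm_iteratedFDeriv_mul_le (contDiff_gridBump _ M m) (hcR m) x
      (by exact_mod_cast hn)).trans_eq (Finset.sum_eq_zero fun k hk => ?_)) (norm_nonneg _)
    rw [iteratedFDeriv_gridBump_eq_zero
      ((Nat.lt_succ_iff.1 (Finset.mem_range.1 hk)).trans hn) hx hi]
    simp
  rw [heq, iteratedFDeriv_sum fun m _ => hc m, Finset.sum_apply]
  refine (norm_sum_le _ _).trans ?_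
  rw [← Finset.sum_filter_add_sum_filter_not _
    (fun m : Fin d → Fin (M + 1) => ∀ i, |x i - gridPoint M m i| ≤ ((max M 1 : ℕ) : ℝ)⁻¹),
    Finset.sum_eq_zero (s := Finset.univ.filter fun m : Fin d → Fin (M + 1) =>
      ¬ ∀ i, |x i - gridPoint M m i| ≤ ((max M 1 : ℕ) : ℝ)⁻¹)
      fun m hm => hfar m (Finset.mem_filter.1 hm).2, add_zero]
  refine (Finset.sum_le_card_nsmul _ _ _ fun m hm =>
    hf.norm_iteratedFDeriv_gridBump_mul_le hβ hd hH hK hKM hn hx (Finset.mem_filter.1 hm).2).trans ?_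
  rw [nsmul_eq_mul]
  refine mul_le_mul_of_nonneg_right ?_ (by positivity)
  exact_mod_cast card_near_gridPoint_le M x

end localTaylor

section assembly

variable {d : ℕ}

theorem localTaylor_eq_sum (s M : ℕ) (f : (Fin d → ℝ) → ℝ) (x : Fin d → ℝ) :
    localTaylor s M f x = ∑ τ : Fin d → Fin (M + 1) × Fin (s + 1),
      taylorCoeff s f (gridPoint M fun i => (τ i).1) (fun i => (τ i).2) *
        ∏ i, bump (s + 1) M (τ i).1 (x i) * (x i - ((τ i).1 : ℕ) / (M : ℝ)) ^ ((τ i).2 : ℕ) := by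
  rw [← (Equiv.arrowProdEquivProdArrow (Fin d) (fun _ => Fin (M + 1))
    (fun _ => Fin (s + 1))).symm.sum_comp, Fintype.sum_prod_type]
  refine Finset.sum_congr rfl fun m _ => ?_
  rw [taylorPoly, Finset.mul_sum]
  refine Finset.sum_congr rfl fun γ _ => ?_
  rw [Finset.prod_mul_distrib, mul_left_comm]
  rfl

theorem holderNormLeOn_of_norm_iteratedFDeriv_le {s ℓ : ℕ} {g : (Fin d → ℝ) → ℝ}
    (hg : ContDiff ℝ s g) (hℓ : ℓ ≤ s) {E : ℝ}
    (h : ∀ n ≤ ℓ, ∀ x ∈ cube d, 2 * ‖iteratedFDeriv ℝ n g x‖ ≤ E) :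
    HolderNormLeOn (cube d) ℓ g E := by
  have hgn : ∀ n ≤ ℓ, ContDiff ℝ n g := fun n hn => hg.of_le (by exact_mod_cast hn.trans hℓ)
  cases ℓ with
  | zero =>
    intro x hx
    have := h 0 le_rfl x hx
    rw [norm_iteratedFDeriv_zero, Real.norm_eq_abs] at this
    linarith [abs_nonneg (g x)]
  | succ m =>
    refine ⟨fun γ hγ x hx => ?_, fun γ hγ x hx y hy _ => ?_⟩
    · have h1 := abs_mderiv_le rfl (hgn _ (hγ.trans m.le_succ)) x
      have h2 := h _ (hγ.trans m.le_succ) x hx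
      linarith [norm_nonneg (iteratedFDeriv ℝ (∑ i, γ i) g x)]
    · have h1 := abs_mderiv_sub_le hγ (hgn m m.le_succ) x y
      have hE : 0 ≤ E := (mul_nonneg zero_le_two (norm_nonneg _)).trans (h m m.le_succ x hx)
      rw [mul_min_of_nonneg _ _ hE, mul_one]
      refine h1.trans (le_min ?_ ?_)
      · linarith [norm_sub_le (iteratedFDeriv ℝ m g x) (iteratedFDeriv ℝ m g y),
          h m m.le_succ x hx, h m m.le_succ y hy]
      · have hdiff : Differentiable ℝ (iteratedFDeriv ℝ m g) :=
          (hgn (m + 1) le_rfl).differentiable_iteratedFDeriv (by norm_cast; omega)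
        refine ((convex_Icc (0 : Fin d → ℝ) 1).norm_image_sub_le_of_norm_fderiv_le (𝕜 := ℝ)
          (f := iteratedFDeriv ℝ m g) (C := E) (fun z _ => hdiff z) (fun z hz => ?_) hy hx).trans ?_
        · rw [norm_fderiv_iteratedFDeriv]
          linarith [h (m + 1) le_rfl z hz, norm_nonneg (iteratedFDeriv ℝ (m + 1) g z)]
        · exact mul_le_mul_of_nonneg_left (norm_sub_le_eucDist x y) hE

end assembly

theorem pow_le_pow_rpow {c : ℝ} (hc : 1 ≤ c) {k : ℕ} (a : ℕ) {t : ℝ} (h : (k : ℝ) ≤ a * t) :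
    c ^ k ≤ (c ^ a) ^ t := by
  have hc0 : 0 ≤ c := by linarith
  rw [← Real.rpow_natCast c k, ← Real.rpow_natCast c a, ← Real.rpow_mul hc0]
  exact Real.rpow_le_rpow_of_exponent_le hc h

theorem error_constant_le {β H : ℝ} {d K n ℓ s : ℕ} (hβ : 2 < β) (hd : 0 < d) (hH : 0 < H)
    (hK : 2 ≤ K) (hs : (s : ℝ) ≤ β) (hn : n ≤ ℓ) (hℓ : ℓ ≤ s) :
    2 * (3 ^ d * ((2 * 6 ^ (s + 1)) ^ d * d ^ (s + 1) * H * (2 * d) ^ n *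
        (3 ^ β * (s + 1 : ℕ) * 3 ^ (s + 1) * (K : ℝ) ^ (n - β)))) ≤
      (10 ^ 7) ^ (β * (d : ℝ)) * H * β ^ ℓ / (K : ℝ) ^ (β - (ℓ : ℝ)) := by
  have hd1 : (1 : ℝ) ≤ d := by exact_mod_cast hd
  have hK1 : (1 : ℝ) ≤ K := by exact_mod_cast (by omega : 1 ≤ K)
  have hnℓ : (n : ℝ) ≤ ℓ := by exact_mod_cast hn
  have hℓs : (ℓ : ℝ) ≤ s := by exact_mod_cast hℓ
  obtain ⟨t, ht⟩ : ∃ t, t = β * (d : ℝ) := ⟨_, rfl⟩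
  have hβt : β ≤ t := by rw [ht]; exact le_mul_of_one_le_right (by linarith) hd1
  have hdt : (d : ℝ) ≤ t := by rw [ht]; exact le_mul_of_one_le_left (by linarith) (by linarith)
  have hd2 : (d : ℝ) ≤ 2 ^ d := by exact_mod_cast Nat.lt_two_pow_self.le
  have hq2 : ((s + 1 : ℕ) : ℝ) ≤ 2 ^ (s + 1) := by exact_mod_cast Nat.lt_two_pow_self.le
  have e1 : (2 : ℝ) ^ 1 ≤ (2 ^ 1) ^ t := pow_le_pow_rpow (by norm_num) 1 (by push_cast; linarith)
  have e2 : (6 : ℝ) ^ d ≤ (6 ^ 1) ^ t := pow_le_pow_rpow (by norm_num) 1 (by push_cast; linarith)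
  have e3 : (6 : ℝ) ^ ((s + 1) * d) ≤ (6 ^ 2) ^ t := pow_le_pow_rpow (by norm_num) 2 (by
    push_cast; rw [ht]; nlinarith)
  have e4 : (2 : ℝ) ^ (d * (s + 1 + n)) ≤ (2 ^ 4) ^ t := pow_le_pow_rpow (by norm_num) 4 (by
    push_cast; rw [ht]; nlinarith)
  have e5 : (2 : ℝ) ^ n ≤ (2 ^ 1) ^ t := pow_le_pow_rpow (by norm_num) 1 (by push_cast; linarith)
  have e6 : (3 : ℝ) ^ β ≤ 3 ^ t := Real.rpow_le_rpow_of_exponent_le (by norm_num) hβt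
  have e7 : (2 : ℝ) ^ (s + 1) ≤ (2 ^ 2) ^ t := pow_le_pow_rpow (by norm_num) 2 (by
    push_cast; linarith)
  have e8 : (3 : ℝ) ^ (s + 1) ≤ (3 ^ 2) ^ t := pow_le_pow_rpow (by norm_num) 2 (by
    push_cast; linarith)
  have e9 : (K : ℝ) ^ (n - β) ≤ 1 / (K : ℝ) ^ (β - (ℓ : ℝ)) := by
    rw [one_div, ← Real.rpow_neg (by linarith)]
    exact Real.rpow_le_rpow_of_exponent_le hK1 (by linarith)
  have e10 : (1 : ℝ) ≤ β ^ ℓ := one_le_pow₀ (by linarith)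
  rw [← ht]
  calc _ = 2 ^ 1 * 6 ^ d * 6 ^ ((s + 1) * d) * (d : ℝ) ^ (s + 1 + n) * 2 ^ n * 3 ^ β *
        (s + 1 : ℕ) * 3 ^ (s + 1) * H * 1 * (K : ℝ) ^ (n - β) := by
        rw [mul_pow 2 (6 ^ (s + 1)), mul_pow 2 (d : ℝ), ← pow_mul, pow_add (d : ℝ),
          show (6 : ℝ) ^ d = 3 ^ d * 2 ^ d by rw [← mul_pow]; norm_num]
        ring
    _ ≤ (2 ^ 1) ^ t * (6 ^ 1) ^ t * (6 ^ 2) ^ t * (2 ^ 4) ^ t * (2 ^ 1) ^ t * 3 ^ t *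
        (2 ^ 2) ^ t * (3 ^ 2) ^ t * H * β ^ ℓ * (1 / (K : ℝ) ^ (β - (ℓ : ℝ))) := by
        have e4' : (d : ℝ) ^ (s + 1 + n) ≤ (2 ^ 4) ^ t := by
          refine le_trans ?_ e4
          rw [pow_mul]
          gcongr
        gcongr
        exact hq2.trans e7
    _ ≤ (10 ^ 7) ^ t * H * β ^ ℓ * (1 / (K : ℝ) ^ (β - (ℓ : ℝ))) := by
        rw [← Real.mul_rpow (by norm_num) (by norm_num), ← Real.mul_rpow (by norm_num) (by norm_num),
          ← Real.mul_rpow (by norm_num) (by norm_num), ← Real.mul_rpow (by norm_num) (by norm_num),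
          ← Real.mul_rpow (by norm_num) (by norm_num), ← Real.mul_rpow (by norm_num) (by norm_num),
          ← Real.mul_rpow (by norm_num) (by norm_num)]
        gcongr
        · linarith
        · norm_num
    _ = _ := by ring

theorem exists_four_pow_two_pow_ge (H : ℝ) : ∃ r : ℕ, H ≤ 4 ^ 2 ^ r ∧
    (r : ℝ) ≤ 2 * Real.log (Real.log (max H 4)) + 1 := by
  obtain ⟨T, hT⟩ : ∃ T, T = max H 4 := ⟨_, rfl⟩
  have hT4 : 4 ≤ T := hT ▸ le_max_right _ _
  have hl4 : 1 ≤ Real.log 4 := by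
    have : Real.log 4 = 2 * Real.log 2 := by
      rw [show (4 : ℝ) = 2 ^ 2 by norm_num, Real.log_pow]; norm_num
    linarith [Real.log_two_gt_d9]
  have hlT : Real.log 4 ≤ Real.log T := Real.log_le_log (by norm_num) hT4
  have hx1 : 1 ≤ Real.log T / Real.log 4 := (one_le_div (by linarith)).2 hlT
  have hx0 : 0 < Real.log T / Real.log 4 := by linarith
  refine ⟨⌈Real.logb 2 (Real.log T / Real.log 4)⌉₊, ?_, ?_⟩
  · have h1 : Real.log T / Real.log 4 ≤ 2 ^ ⌈Real.logb 2 (Real.log T / Real.log 4)⌉₊ := by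
      rw [← Real.rpow_natCast, ← Real.logb_le_iff_le_rpow (by norm_num) hx0]
      exact Nat.le_ceil _
    calc H ≤ T := hT ▸ le_max_left _ _
      _ ≤ _ := by
        rw [← Real.log_le_log_iff (by linarith) (by positivity), Real.log_pow]
        rw [div_le_iff₀ (by linarith)] at h1
        exact_mod_cast h1
  · have h0 : 0 ≤ Real.logb 2 (Real.log T / Real.log 4) := Real.logb_nonneg (by norm_num) hx1
    refine (Nat.ceil_lt_add_one h0).le.trans ?_
    rw [← hT, Real.logb, Real.log_div (by linarith) (by linarith)]
    have h2 : 0 ≤ Real.log (Real.log T) := Real.log_nonneg (by linarith)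
    have h4 : 0 ≤ Real.log (Real.log 4) := Real.log_nonneg hl4
    have h3 : (Real.log (Real.log T) - Real.log (Real.log 4)) / Real.log 2 ≤
        2 * Real.log (Real.log T) := by
      rw [div_le_iff₀ (by linarith [Real.log_two_gt_d9])]
      nlinarith [Real.log_two_gt_d9]
    linarith

theorem log_log_max_four_nonneg (H : ℝ) : 0 ≤ Real.log (Real.log (max H 4)) := by
  refine Real.log_nonneg ((Real.le_log_iff_exp_le (by positivity)).2 ?_)
  exact (Real.exp_one_lt_three.le.trans (by norm_num)).trans (le_max_right H 4)

theorem clog_two_le (d : ℕ) (hd : 0 < d) : (Nat.clog 2 d : ℝ) ≤ 2 * Real.log d + 1 := by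
  have h1 : (1 : ℝ) ≤ d := by exact_mod_cast hd
  have h : (⌈Real.logb 2 d⌉₊ : ℝ) < Real.logb 2 d + 1 :=
    Nat.ceil_lt_add_one (Real.logb_nonneg (by norm_num) h1)
  rw [show Nat.clog 2 d = ⌈Real.logb 2 d⌉₊ by
    exact_mod_cast (Real.natCeil_logb_natCast 2 d).symm]
  have h3 : Real.logb 2 d ≤ 2 * Real.log d := by
    rw [Real.logb, div_le_iff₀ (by linarith [Real.log_two_gt_d9])]
    nlinarith [Real.log_two_gt_d9, Real.log_nonneg h1]
  linarith

theorem exists_mesh {K s : ℕ} (hK : 0 < K) :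
    ∃ M, (M + 1) * (s + 1) ≤ K + s ∧ K ≤ 3 * (max M 1 * (s + 1)) := by
  obtain ⟨m, hm⟩ : ∃ m, m = (K + s) / (s + 1) := ⟨_, rfl⟩
  have h1 : m * (s + 1) ≤ K + s := hm ▸ Nat.div_mul_le_self _ _
  have h2 : K + s < (m + 1) * (s + 1) := by
    rw [hm, mul_comm]
    exact Nat.lt_mul_div_succ _ s.succ_pos
  have h3 : 1 ≤ m := hm ▸ (Nat.one_le_div_iff s.succ_pos).2 (by omega)
  refine ⟨m - 1, by rwa [Nat.sub_add_cancel h3], ?_⟩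
  calc K ≤ (m + 1) * (s + 1) := by omega
    _ ≤ (3 * max (m - 1) 1) * (s + 1) := Nat.mul_le_mul_right _ (by omega)
    _ = _ := mul_assoc _ _ _

theorem statement1 :
    ∃ C : ℝ, 0 < C ∧
      ∀ β : ℝ, 2 < β → ∀ p d : ℕ, 0 < p → 0 < d → ∀ H : ℝ, 0 < H →
        ∀ f : (Fin d → ℝ) → Fin p → ℝ, MemHolderBall p β H f →
          ∀ K : ℕ, 2 ≤ K →
            ∃ N : ReQUNet,
              N.arch 0 = d ∧ N.arch (N.L + 1) = p ∧
              N.weightsIn (Set.Icc (-1) 1) ∧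
              (N.L : ℝ) ≤ C * (Real.log (d : ℝ) + (lfloor β : ℝ) +
                  Real.log (Real.log (max H 4))) ∧
              (N.width : ℝ) ≤ C * max (p : ℝ) ((d : ℝ) * (((K + lfloor β : ℕ) : ℝ)) ^ d) ∧
              (N.numNonzero : ℝ) ≤ C * (p : ℝ) *
                  ((d : ℝ) * β + (d : ℝ) ^ 2 + Real.log (Real.log (max H 4))) *
                  ((K + lfloor β : ℕ) : ℝ) ^ d ∧
              ∀ ℓ : ℕ, ℓ ≤ lfloor β →
                VHolderNormLe p ℓ (fun x i => f x i - N.evalVec d x (i : ℕ))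
                  (C ^ (β * (d : ℝ)) * H * β ^ ℓ / (K : ℝ) ^ (β - (ℓ : ℝ))) := by

  refine ⟨10 ^ 7, by norm_num, ?_⟩
  intro β hβ p d hp hd H hH f hf K hK
  have hlt := lfloor_lt (show 0 < β by linarith)
  have hle := le_lfloor_add_one β
  have hf1 : ∀ j, MemHolderBall1 β H fun x => f x j := fun j => ⟨hf.1 j, hf.2.1 j, hf.2.2 j⟩
  obtain ⟨M, hM, hKM⟩ := exists_mesh (K := K) (s := lfloor β) (by omega)
  obtain ⟨r, hr, hrl⟩ := exists_four_pow_two_pow_ge H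
  have hLL := log_log_max_four_nonneg H
  have hs2 : 2 ≤ lfloor β := by
    have : (1 : ℝ) < lfloor β := by linarith
    exact_mod_cast this
  have hs2' : (2 : ℝ) ≤ lfloor β := by exact_mod_cast hs2
  have hd1 : (1 : ℝ) ≤ d := by exact_mod_cast hd
  have hp1 : (1 : ℝ) ≤ p := by exact_mod_cast hp
  obtain ⟨N, h0, h1, hw, hL, hwidth, hnnz, heval⟩ := exists_net_sum_bump hd
    (by omega : 2 ≤ lfloor β + 1) hM r
    (fun (j : Fin p) (τ : Fin d → Fin (M + 1) × Fin (lfloor β + 1)) =>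
      taylorCoeff (lfloor β) (fun x => f x j) (gridPoint M fun i => (τ i).1) fun i => (τ i).2)
    fun j τ => (abs_taylorCoeff_le hH.le
      (fun γ hγ => (hf1 j).2.1 γ hγ _ (gridPoint_mem_cube M _)) _).trans hr
  refine ⟨N, h0, h1, hw, ?_, ?_, ?_, ?_⟩
  · have hc := clog_two_le d hd
    have hlogd := Real.log_nonneg hd1
    rw [hL]
    push_cast
    linarith
  · have h : (N.width : ℝ) ≤ max (16 * (d * ((K + lfloor β : ℕ) : ℝ) ^ d)) p := by
      exact_mod_cast hwidth
    refine h.trans (max_le ?_ ?_)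
    · exact mul_le_mul (by norm_num) (le_max_right _ _) (by positivity) (by norm_num)
    · exact (le_max_left _ _).trans (le_mul_of_one_le_left (by positivity) (by norm_num))
  · have h : (N.numNonzero : ℝ) ≤ (1000 * (d * ((lfloor β : ℝ) + 1) + d * Nat.clog 2 d + r) + 4 * p) *
        ((K + lfloor β : ℕ) : ℝ) ^ d := by
      exact_mod_cast hnnz
    refine h.trans (mul_le_mul_of_nonneg_right ?_ (by positivity))
    have hc : (Nat.clog 2 d : ℝ) ≤ d := by
      exact_mod_cast Nat.clog_le_of_le_pow Nat.lt_two_pow_self.le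
    have a1 : (d : ℝ) * ((lfloor β : ℝ) + 1) ≤ 2 * (d * β) := by nlinarith
    have a2 : (d : ℝ) * Nat.clog 2 d ≤ d ^ 2 := by nlinarith
    have a3 : 1 ≤ (d : ℝ) ^ 2 := one_le_pow₀ hd1
    have a4 : 0 ≤ (d : ℝ) * β := by positivity
    have a5 : 1 ≤ d * β + (d : ℝ) ^ 2 + Real.log (Real.log (max H 4)) := by linarith
    calc _ ≤ 3000 * (d * β + (d : ℝ) ^ 2 + Real.log (Real.log (max H 4))) + 4 * p := by linarith
      _ ≤ 3000 * (p * (d * β + (d : ℝ) ^ 2 + Real.log (Real.log (max H 4)))) +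
          4 * (p * (d * β + (d : ℝ) ^ 2 + Real.log (Real.log (max H 4)))) := by
          gcongr
          · exact le_mul_of_one_le_left (by linarith) hp1
          · exact le_mul_of_one_le_right (by linarith) a5
      _ ≤ _ := by
          have := mul_nonneg (zero_le_one.trans hp1) (zero_le_one.trans a5)
          linarith
  · intro ℓ hℓ j
    have hg : (fun x => f x j - N.evalVec d x (j : ℕ)) =
        fun x => f x j - localTaylor (lfloor β) M (fun x => f x j) x := by
      funext x
      rw [heval, localTaylor_eq_sum]
    dsimp only
    rw [hg]
    refine holderNormLeOn_of_norm_iteratedFDeriv_le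
      ((hf1 j).contDiff.sub (contDiff_localTaylor _ M _)) hℓ fun n hn x hx => ?_
    refine le_trans (mul_le_mul_of_nonneg_left ((hf1 j).norm_iteratedFDeriv_sub_localTaylor_le
      (by linarith) hd hH.le (by omega) hKM (hn.trans hℓ) hx) zero_le_two) ?_
    exact error_constant_le hβ hd hH hK hlt.le hn hℓ
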